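/- arXiv:2112.09962 — 4 statements merged into one kernel-verified Lean document; each statement's English description precedes it below -/
import Mathlib

section
/- Let α ≥ -1, p > 2 and let f be holomorphic on 𝔻. Then the following identity holds (as an equality in [0, ∞], both sides possibly infinite): ‖f‖^p_{A^p_{(p/2)(α+2)−2}} = |f(0)|^p + (p²/4) ∫_𝔻 |f'(z)|² |f(z)|^{p−2} (1−|z|²)^{p(α+2)/2} ( ∫₀¹ s^{p(α+2)/2 − 1} / (1 − (1−|z|²)s) ds ) dA(z). -/
open MeasureTheory Set Filter
open scoped ENNReal NNReal Topology

noncomputable section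

/-- The open unit disk in `ℂ`. -/
def unitDisk : Set ℂ := Metric.ball 0 1

/-- `c_β(n) = Γ(n+β)/(Γ(β)·n!)`. -/
def ccoef (β : ℝ) (n : ℕ) : ℝ := Real.Gamma (n + β) / (Real.Gamma β * n.factorial)

/-- The `n`-th Taylor coefficient of `f` at the origin. -/
def taylorCoeff (f : ℂ → ℂ) (n : ℕ) : ℂ := iteratedDeriv n f 0 / n.factorial

/-- The square of the `A²_α` norm, `∑ |a_n|²/c_{α+2}(n)`, valued in `[0,∞]`. -/
def A2normSq (α : ℝ) (f : ℂ → ℂ) : ℝ≥0∞ :=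
  ∑' n : ℕ, ENNReal.ofReal (‖taylorCoeff f n‖ ^ 2 / ccoef (α + 2) n)

/-- The `A²_α` norm (Hardy `H²` norm when `α = -1`). -/
def A2norm (α : ℝ) (f : ℂ → ℂ) : ℝ≥0∞ := A2normSq α f ^ (1 / 2 : ℝ)

/-- The `p`-th power of the weighted Bergman norm `‖f‖_{A^p_β}`, valued in `[0,∞]`:
`(β+1) ∫_𝔻 (1-|z|²)^β |f z|^p dA(z)` with `dA` the normalized area measure. -/
def ApIntPow (p β : ℝ) (f : ℂ → ℂ) : ℝ≥0∞ :=
  ENNReal.ofReal (β + 1) *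
    (∫⁻ z in unitDisk, ENNReal.ofReal ((1 - ‖z‖ ^ 2) ^ β * ‖f z‖ ^ p)) / ENNReal.ofReal Real.pi

/-- The weighted Bergman norm `‖f‖_{A^p_β}`, valued in `[0,∞]`. -/
def ApNorm (p β : ℝ) (f : ℂ → ℂ) : ℝ≥0∞ := ApIntPow p β f ^ (1 / p)

/-- The inner integral `∫₀¹ s^{α+1}/(1-(1-|z|²)s) ds`, valued in `[0,∞]`. -/
def Hinner (α : ℝ) (z : ℂ) : ℝ≥0∞ :=
  ∫⁻ s in Set.Ioo (0 : ℝ) 1, ENNReal.ofReal (s ^ (α + 1) / (1 - (1 - ‖z‖ ^ 2) * s))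

/-- The quantity `F_p(f)`. -/
def Ffun (α p : ℝ) (f : ℂ → ℂ) : ℝ≥0∞ :=
  ENNReal.ofReal (‖f 0‖ ^ p) +
    ENNReal.ofReal (p / 2) *
      (∫⁻ z in unitDisk,
        ENNReal.ofReal (‖deriv f z‖ ^ 2 * ‖f z‖ ^ (p - 2) * (1 - ‖z‖ ^ 2) ^ (p * (α + 2) / 2)) *
          Hinner α z) / ENNReal.ofReal Real.pi

/-- The quantity `G_p(f)`. -/
def Gfun (α p : ℝ) (f : ℂ → ℂ) : ℝ≥0∞ :=
  ENNReal.ofReal (p / (2 * (α + 2))) *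
    (∫⁻ z in unitDisk,
      ENNReal.ofReal (‖deriv f z‖ ^ 2 * ‖f z‖ ^ (p - 2) * (1 - ‖z‖ ^ 2) ^ (p * (α + 2) / 2))) /
    ENNReal.ofReal Real.pi

/-- Tonelli's theorem on the triangle `τ < t < 0`. -/
theorem lintegral_Iio_mul_lintegral_Iio {w h : ℝ → ℝ≥0∞}
    (hw : AEMeasurable w (volume.restrict (Iio 0))) (hh : AEMeasurable h (volume.restrict (Iio 0))) :
    ∫⁻ t in Iio (0 : ℝ), w t * ∫⁻ τ in Iio t, h τ =
      ∫⁻ τ in Iio (0 : ℝ), h τ * ∫⁻ t in Ioo τ 0, w t := by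
  have key : ∀ t < (0 : ℝ), ∫⁻ τ in Iio t, h τ = ∫⁻ τ in Iio 0, (Iio t).indicator h τ := by
    intro t ht
    rw [lintegral_indicator measurableSet_Iio, Measure.restrict_restrict measurableSet_Iio,
      inter_eq_self_of_subset_left (Iio_subset_Iio ht.le)]
  have key' : ∀ τ : ℝ, ∫⁻ t in Ioo τ 0, w t = ∫⁻ t in Iio 0, (Ioi τ).indicator w t := by
    intro τ
    rw [lintegral_indicator measurableSet_Ioi, Measure.restrict_restrict measurableSet_Ioi,
      Ioi_inter_Iio]
  have hL : ∀ t ∈ Iio (0 : ℝ), w t * ∫⁻ τ in Iio t, h τ =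
      ∫⁻ τ in Iio 0, w t * (Iio t).indicator h τ := by
    intro t ht
    rw [key t ht, lintegral_const_mul'' _ (hh.indicator measurableSet_Iio)]
  have hR : ∀ τ ∈ Iio (0 : ℝ), h τ * ∫⁻ t in Ioo τ 0, w t =
      ∫⁻ t in Iio 0, h τ * (Ioi τ).indicator w t := by
    intro τ _
    rw [key' τ, lintegral_const_mul'' _ (hw.indicator measurableSet_Ioi)]
  rw [setLIntegral_congr_fun measurableSet_Iio hL, setLIntegral_congr_fun measurableSet_Iio hR,
    lintegral_lintegral_swap]
  · refine lintegral_congr fun τ => lintegral_congr fun t => ?_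
    by_cases hτ : τ < t <;> simp [hτ, mul_comm]
  · have h1 : AEMeasurable (fun x : ℝ × ℝ => w x.1 * h x.2)
        ((volume.restrict (Iio 0)).prod (volume.restrict (Iio 0))) :=
      hw.comp_fst.mul hh.comp_snd
    have h2 : MeasurableSet {x : ℝ × ℝ | x.2 < x.1} :=
      measurableSet_lt measurable_snd measurable_fst
    refine (h1.indicator h2).congr (ae_of_all _ fun x => ?_)
    by_cases hx : x.2 < x.1 <;> simp [Function.uncurry, indicator, hx]

/-- Improper fundamental theorem of calculus at `-∞` for nonnegative integrands, in terms of
lower integrals. -/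
theorem lintegral_Iio_ofReal_of_tendsto {G g : ℝ → ℝ} {b L : ℝ}
    (hg : ContinuousOn g (Iic b)) (hg0 : ∀ x ≤ b, 0 ≤ g x)
    (hG : ∀ a ≤ b, G b - G a = ∫ x in a..b, g x) (hL : Tendsto G atBot (𝓝 L)) :
    ∫⁻ x in Iio b, ENNReal.ofReal (g x) = ENNReal.ofReal (G b - L) := by
  have hm : AEMeasurable (fun x => ENNReal.ofReal (g x)) (volume.restrict (Iic b)) :=
    (hg.aemeasurable measurableSet_Iic).ennreal_ofReal
  rw [setLIntegral_congr Iio_ae_eq_Iic]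
  have hT := (aecover_Ioi (μ := volume.restrict (Iic b)) (l := atBot) (a := fun x : ℝ => x)
    tendsto_id).lintegral_tendsto_of_countably_generated hm
  refine tendsto_nhds_unique hT ?_
  have hT' : Tendsto (fun a => ENNReal.ofReal (G b - G a)) atBot (𝓝 (ENNReal.ofReal (G b - L))) :=
    (ENNReal.continuous_ofReal.tendsto _).comp (tendsto_const_nhds.sub hL)
  refine hT'.congr' ?_
  filter_upwards [eventually_le_atBot b] with a ha
  rw [Measure.restrict_restrict measurableSet_Ioi, Ioi_inter_Iic, hG a ha,
    intervalIntegral.integral_of_le ha, ofReal_integral_eq_lintegral_ofReal]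
  · exact ((hg.mono Icc_subset_Iic_self).integrableOn_Icc).mono_set Ioc_subset_Icc_self
  · filter_upwards [ae_restrict_mem measurableSet_Ioc] with x hx using hg0 x hx.2

theorem one_sub_exp_two_mul_pos {t : ℝ} (ht : t < 0) : 0 < 1 - Real.exp (2 * t) := by
  have := Real.exp_lt_one_iff.2 (show 2 * t < 0 by linarith)
  linarith

theorem one_sub_exp_two_mul_lt_one (t : ℝ) : 1 - Real.exp (2 * t) < 1 := by
  linarith [Real.exp_pos (2 * t)]

theorem hasDerivAt_one_sub_exp_two_mul (t : ℝ) :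
    HasDerivAt (fun t : ℝ => 1 - Real.exp (2 * t)) (-(2 * Real.exp (2 * t))) t := by
  have := (((hasDerivAt_id t).const_mul (2 : ℝ)).exp).const_sub 1
  simpa [mul_comm] using this

theorem strictAnti_one_sub_exp_two_mul : StrictAnti (fun t : ℝ => 1 - Real.exp (2 * t)) := by
  intro a b hab
  have := Real.exp_lt_exp.2 (show 2 * a < 2 * b by linarith)
  simp only
  linarith

theorem image_one_sub_exp_two_mul_Ioo {σ : ℝ} :
    (fun t : ℝ => 1 - Real.exp (2 * t)) '' Ioo σ 0 = Ioo 0 (1 - Real.exp (2 * σ)) := by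
  ext s
  constructor
  · rintro ⟨t, ⟨h1, h2⟩, rfl⟩
    exact ⟨one_sub_exp_two_mul_pos h2, strictAnti_one_sub_exp_two_mul h1⟩
  · rintro ⟨h1, h2⟩
    have hs : 0 < 1 - s := by linarith [Real.exp_pos (2 * σ)]
    refine ⟨Real.log (1 - s) / 2, ⟨?_, ?_⟩, ?_⟩
    · have := Real.lt_log_iff_exp_lt hs |>.2 (show Real.exp (2 * σ) < 1 - s by linarith)
      linarith
    · have := Real.log_neg hs (by linarith)
      linarith
    · simp only
      rw [mul_div_cancel₀ _ two_ne_zero, Real.exp_log hs]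
      ring

theorem image_one_sub_exp_two_mul_Iio :
    (fun t : ℝ => 1 - Real.exp (2 * t)) '' Iio 0 = Ioo 0 1 := by
  ext s
  constructor
  · rintro ⟨t, h2, rfl⟩
    exact ⟨one_sub_exp_two_mul_pos h2, one_sub_exp_two_mul_lt_one t⟩
  · rintro ⟨h1, h2⟩
    have hs : 0 < 1 - s := by linarith
    refine ⟨Real.log (1 - s) / 2, ?_, ?_⟩
    · have := Real.log_neg hs (by linarith)
      simp only [mem_Iio]
      linarith
    · simp only
      rw [mul_div_cancel₀ _ two_ne_zero, Real.exp_log hs]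
      ring

theorem lintegral_Ioo_rpow {β c : ℝ} (hβ : -1 < β) (hc : 0 ≤ c) :
    ∫⁻ s in Ioo 0 c, ENNReal.ofReal (s ^ β) = ENNReal.ofReal (c ^ (β + 1) / (β + 1)) := by
  have hi := (intervalIntegral.intervalIntegrable_rpow' (a := 0) (b := c) hβ)
  rw [intervalIntegrable_iff_integrableOn_Ioo_of_le hc] at hi
  rw [← ofReal_integral_eq_lintegral_ofReal hi, ← integral_Ioc_eq_integral_Ioo,
    ← intervalIntegral.integral_of_le hc, integral_rpow (Or.inl hβ),
    Real.zero_rpow (by linarith), sub_zero]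
  filter_upwards [ae_restrict_mem measurableSet_Ioo] with x hx using Real.rpow_nonneg hx.1.le _

theorem lintegral_exp_mul_image {S : Set ℝ} (hS : MeasurableSet S) (h : ℝ → ℝ≥0∞) :
    ∫⁻ s in (fun t : ℝ => 1 - Real.exp (2 * t)) '' S, h s =
      ∫⁻ t in S, ENNReal.ofReal (2 * Real.exp (2 * t)) * h (1 - Real.exp (2 * t)) := by
  rw [lintegral_image_eq_lintegral_abs_deriv_mul hS
    (fun x _ => (hasDerivAt_one_sub_exp_two_mul x).hasDerivWithinAt)
    strictAnti_one_sub_exp_two_mul.injective.injOn]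
  simp [abs_neg]

theorem lintegral_weight_of_image {β c : ℝ} {S : Set ℝ} (hS : MeasurableSet S) (hβ : -1 < β)
    (hc : 0 ≤ c) (hSc : (fun t : ℝ => 1 - Real.exp (2 * t)) '' S = Ioo 0 c) :
    ∫⁻ t in S, ENNReal.ofReal (Real.exp (2 * t) * (1 - Real.exp (2 * t)) ^ β) =
      ENNReal.ofReal (c ^ (β + 1) / (2 * (β + 1))) := by
  have h := lintegral_exp_mul_image hS (fun s => ENNReal.ofReal (s ^ β / 2))
  rw [hSc] at h
  have e : ∀ t, ENNReal.ofReal (2 * Real.exp (2 * t)) *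
      ENNReal.ofReal ((1 - Real.exp (2 * t)) ^ β / 2) =
      ENNReal.ofReal (Real.exp (2 * t) * (1 - Real.exp (2 * t)) ^ β) := by
    intro t
    rw [← ENNReal.ofReal_mul (by positivity)]
    congr 1
    ring
  simp only [e] at h
  rw [← h]
  simp only [div_eq_mul_inv _ (2 : ℝ), ENNReal.ofReal_mul' (show (0 : ℝ) ≤ 2⁻¹ by norm_num)]
  rw [lintegral_mul_const' _ _ ENNReal.ofReal_ne_top, lintegral_Ioo_rpow hβ hc,
    ← ENNReal.ofReal_mul' (by norm_num)]
  congr 1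
  field_simp

theorem lintegral_Ioo_rpow_one_sub_exp {γ σ : ℝ} (hσ : σ < 0) :
    ∫⁻ τ in Ioo σ 0, ENNReal.ofReal ((1 - Real.exp (2 * τ)) ^ (γ - 1)) =
      ENNReal.ofReal ((1 - Real.exp (2 * σ)) ^ γ / 2) *
        ∫⁻ s in Ioo (0 : ℝ) 1,
          ENNReal.ofReal (s ^ (γ - 1) / (1 - (1 - Real.exp (2 * σ)) * s)) := by
  set c := 1 - Real.exp (2 * σ) with hc
  have hc0 : 0 < c := one_sub_exp_two_mul_pos hσ
  have himg : (fun t : ℝ => (1 - Real.exp (2 * t)) / c) '' Ioo σ 0 = Ioo 0 1 := by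
    have : (fun t : ℝ => (1 - Real.exp (2 * t)) / c) =
        (fun x => x * c⁻¹) ∘ (fun t : ℝ => 1 - Real.exp (2 * t)) := by
      ext t; simp [div_eq_mul_inv]
    rw [this, image_comp, image_one_sub_exp_two_mul_Ioo,
      image_mul_right_Ioo _ _ (inv_pos.2 hc0), zero_mul, mul_inv_cancel₀ hc0.ne']
  rw [← himg, lintegral_image_eq_lintegral_abs_deriv_mul measurableSet_Ioo
    (fun x _ => ((hasDerivAt_one_sub_exp_two_mul x).div_const c).hasDerivWithinAt)
    (fun x _ y _ h => strictAnti_one_sub_exp_two_mul.injective (by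
      simpa [div_left_inj' hc0.ne'] using h)),
    ← lintegral_const_mul' _ _ ENNReal.ofReal_ne_top]
  refine setLIntegral_congr_fun measurableSet_Ioo fun t ht => ?_
  have ht0 := one_sub_exp_two_mul_pos ht.2
  rw [← ENNReal.ofReal_mul (abs_nonneg _), ← ENNReal.ofReal_mul (by positivity)]
  congr 1
  rw [neg_div, abs_neg, abs_of_pos (by positivity), mul_div_cancel₀ _ hc0.ne',
    Real.div_rpow ht0.le hc0.le, Real.rpow_sub_one hc0.ne']
  have := Real.exp_pos (2 * t)
  have := Real.rpow_pos_of_pos hc0 γ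
  field_simp
  ring

/-- The integral of `φ` over the circle of radius `r` about the origin, in the angular variable. -/
def angularIntegral {E : Type*} [NormedAddCommGroup E] [NormedSpace ℝ E] (φ : ℂ → E) (r : ℝ) : E :=
  ∫ θ in -Real.pi..Real.pi, φ (r * Complex.exp (θ * Complex.I))

theorem norm_mul_exp_mul_I (r θ : ℝ) : ‖(r : ℂ) * Complex.exp (θ * Complex.I)‖ = |r| := by
  simp [Complex.norm_exp_ofReal_mul_I]

theorem mul_exp_mul_I_mem_unitDisk {r : ℝ} (hr : r ∈ Ioo (-1 : ℝ) 1) (θ : ℝ) :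
    (r : ℂ) * Complex.exp (θ * Complex.I) ∈ unitDisk := by
  rw [unitDisk, mem_ball_zero_iff, norm_mul_exp_mul_I]
  exact abs_lt.2 hr

theorem continuous_comp_circle {E : Type*} [NormedAddCommGroup E] {φ : ℂ → E}
    (hφ : ContinuousOn φ unitDisk) {r : ℝ} (hr : r ∈ Ioo (-1 : ℝ) 1) :
    Continuous fun θ : ℝ => φ (r * Complex.exp (θ * Complex.I)) :=
  hφ.comp_continuous (by fun_prop) (mul_exp_mul_I_mem_unitDisk hr)

theorem continuousOn_angularIntegral {E : Type*} [NormedAddCommGroup E] [NormedSpace ℝ E]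
    {φ : ℂ → E} (hφ : ContinuousOn φ unitDisk) :
    ContinuousOn (angularIntegral φ) (Ioo (-1) 1) := by
  rw [continuousOn_iff_continuous_domRestrict]
  refine intervalIntegral.continuous_parametric_intervalIntegral_of_continuous'
    (f := fun (r : Ioo (-1 : ℝ) 1) (θ : ℝ) => φ ((r : ℝ) * Complex.exp (θ * Complex.I))) ?_ _ _
  exact hφ.comp_continuous (by fun_prop) fun x => mul_exp_mul_I_mem_unitDisk x.1.2 x.2

theorem exp_mem_Ioo {t : ℝ} (ht : t < 0) : Real.exp t ∈ Ioo (-1 : ℝ) 1 :=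
  ⟨by linarith [Real.exp_pos t], Real.exp_lt_one_iff.2 ht⟩

theorem continuousOn_angularIntegral_exp {E : Type*} [NormedAddCommGroup E] [NormedSpace ℝ E]
    {φ : ℂ → E} (hφ : ContinuousOn φ unitDisk) :
    ContinuousOn (fun t => angularIntegral φ (Real.exp t)) (Iio 0) :=
  (continuousOn_angularIntegral hφ).comp Real.continuous_exp.continuousOn fun _ ht => exp_mem_Ioo ht

theorem tendsto_angularIntegral_exp {E : Type*} [NormedAddCommGroup E] [NormedSpace ℝ E]
    [CompleteSpace E] {φ : ℂ → E} (hφ : ContinuousOn φ unitDisk) :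
    Tendsto (fun t => angularIntegral φ (Real.exp t)) atBot (𝓝 ((2 * Real.pi) • φ 0)) := by
  have h := ((continuousOn_angularIntegral hφ).continuousAt
    (Ioo_mem_nhds (show (-1 : ℝ) < 0 by norm_num) one_pos)).tendsto.comp Real.tendsto_exp_atBot
  have h0 : angularIntegral φ 0 = (2 * Real.pi) • φ 0 := by
    simp [angularIntegral, two_mul]
  rwa [h0] at h

theorem angularIntegral_nonneg {φ : ℂ → ℝ} (hφ : ∀ z, 0 ≤ φ z) (r : ℝ) :
    0 ≤ angularIntegral φ r :=
  intervalIntegral.integral_nonneg (by linarith [Real.pi_pos]) fun _ _ => hφ _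

theorem lintegral_circle {φ : ℂ → ℝ} (hφ : ContinuousOn φ unitDisk) (hφ0 : ∀ z, 0 ≤ φ z)
    {r : ℝ} (hr : r ∈ Ioo (-1 : ℝ) 1) :
    ∫⁻ θ in Ioo (-Real.pi) Real.pi, ENNReal.ofReal (φ (r * Complex.exp (θ * Complex.I))) =
      ENNReal.ofReal (angularIntegral φ r) := by
  have hc := continuous_comp_circle hφ hr
  rw [angularIntegral, intervalIntegral.integral_of_le (by linarith [Real.pi_pos]),
    integral_Ioc_eq_integral_Ioo, ofReal_integral_eq_lintegral_ofReal]
  · exact (hc.integrableOn_Icc).mono_set Ioo_subset_Icc_self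
  · exact ae_of_all _ fun _ => hφ0 _

/-- Integration over the disk in logarithmic polar coordinates. -/
theorem lintegral_unitDisk_eq {φ : ℂ → ℝ} (hφ : ContinuousOn φ unitDisk) (hφ0 : ∀ z, 0 ≤ φ z)
    {v : ℝ → ℝ≥0∞} (hv : Measurable v) :
    ∫⁻ z in unitDisk, ENNReal.ofReal (φ z) * v ‖z‖ =
      ∫⁻ t in Iio (0 : ℝ), ENNReal.ofReal (Real.exp (2 * t)) * v (Real.exp t) *
        ENNReal.ofReal (angularIntegral φ (Real.exp t)) := by
  have hD : MeasurableSet unitDisk := Metric.isOpen_ball.measurableSet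
  set g : ℂ → ℝ≥0∞ := unitDisk.indicator fun z => ENNReal.ofReal (φ z) * v ‖z‖ with hg
  have hgm : Measurable g := by
    have h1 : Measurable (unitDisk.indicator φ) := by
      classical
      have := hφ.measurable_piecewise (g := fun _ => (0 : ℝ)) continuousOn_const hD
      have e : unitDisk.piecewise φ (fun _ => (0 : ℝ)) = unitDisk.indicator φ :=
        piecewise_eq_indicator
      rwa [e] at this
    have h2 : g = fun z => ENNReal.ofReal (unitDisk.indicator φ z) * v ‖z‖ := by
      ext z
      by_cases hz : z ∈ unitDisk <;> simp [g, hz]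
    rw [h2]
    exact h1.ennreal_ofReal.mul (hv.comp measurable_norm)
  have hpc : ∀ p : ℝ × ℝ, Complex.polarCoord.symm p = p.1 * Complex.exp (p.2 * Complex.I) := by
    intro p
    rw [Complex.polarCoord_symm_apply, Complex.exp_mul_I]
    simp
  have hinner : ∀ r ∈ Ioi (0 : ℝ),
      ∫⁻ θ in Ioo (-Real.pi) Real.pi,
        ENNReal.ofReal r * g (r * Complex.exp (θ * Complex.I)) =
      (Ioo (0 : ℝ) 1).indicator (fun r => ENNReal.ofReal r * v r *
        ENNReal.ofReal (angularIntegral φ r)) r := by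
    intro r hr
    have hr : 0 < r := hr
    by_cases hr1 : r < 1
    · have hr' : r ∈ Ioo (-1 : ℝ) 1 := ⟨by linarith, hr1⟩
      rw [indicator_of_mem (show r ∈ Ioo (0 : ℝ) 1 from ⟨hr, hr1⟩), ← lintegral_circle hφ hφ0 hr',
        ← lintegral_const_mul]
      · refine lintegral_congr fun θ => ?_
        rw [hg, indicator_of_mem (mul_exp_mul_I_mem_unitDisk hr' θ), norm_mul_exp_mul_I,
          abs_of_pos hr]
        ring
      · exact (continuous_comp_circle hφ hr').measurable.ennreal_ofReal
    · rw [indicator_of_notMem (fun h => hr1 h.2)]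
      have : ∀ θ : ℝ, g (r * Complex.exp (θ * Complex.I)) = 0 := by
        intro θ
        refine indicator_of_notMem ?_ _
        rw [unitDisk, mem_ball_zero_iff, norm_mul_exp_mul_I, abs_of_pos hr]
        exact hr1
      simp [this]
  have himg : Real.exp '' Iio 0 = Ioo 0 1 := by
    ext s
    constructor
    · rintro ⟨t, ht, rfl⟩
      exact ⟨Real.exp_pos t, Real.exp_lt_one_iff.2 ht⟩
    · rintro ⟨h0, h1⟩
      exact ⟨Real.log s, Real.log_neg h0 h1, Real.exp_log h0⟩
  rw [← lintegral_indicator hD, ← hg, ← Complex.lintegral_comp_polarCoord_symm]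
  simp only [hpc, smul_eq_mul, polarCoord_target]
  rw [Measure.volume_eq_prod, setLIntegral_prod]
  · rw [setLIntegral_congr_fun measurableSet_Ioi hinner, lintegral_indicator measurableSet_Ioo,
      Measure.restrict_restrict measurableSet_Ioo, inter_eq_self_of_subset_left Ioo_subset_Ioi_self,
      ← himg, lintegral_image_eq_lintegral_abs_deriv_mul measurableSet_Iio
        (fun t _ => (Real.hasDerivAt_exp t).hasDerivWithinAt) Real.exp_injective.injOn]
    refine lintegral_congr fun t => ?_
    rw [abs_of_pos (Real.exp_pos t), two_mul, Real.exp_add, ENNReal.ofReal_mul (Real.exp_pos t).le]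
    ring
  · refine (Measurable.mul (by fun_prop) (hgm.comp ?_)).aemeasurable
    fun_prop

/-- Green's theorem on an annulus, in logarithmic polar coordinates. -/
theorem angularIntegral_sub_eq {ψ E : ℂ → ℂ} {ψ' : ℂ → ℂ →L[ℝ] ℂ}
    (hψ : ∀ z ∈ unitDisk, HasFDerivAt ψ (ψ' z) z)
    (hE : ∀ z ∈ unitDisk, ψ' z z + Complex.I * ψ' z (Complex.I * z) = E z)
    (hEc : ContinuousOn E unitDisk) {a b : ℝ} (hab : a ≤ b) (hb : b < 0) :
    angularIntegral ψ (Real.exp b) - angularIntegral ψ (Real.exp a) =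
      ∫ t in a..b, angularIntegral E (Real.exp t) := by
  have hexp : ∀ x y : ℝ, Complex.exp (x + y * Complex.I) =
      (Real.exp x : ℂ) * Complex.exp (y * Complex.I) := by
    intro x y
    rw [Complex.exp_add, Complex.ofReal_exp]
  have hmem : ∀ w : ℂ, w.re < 0 → Complex.exp w ∈ unitDisk := by
    intro w hw
    rw [unitDisk, mem_ball_zero_iff, Complex.norm_exp]
    exact Real.exp_lt_one_iff.2 hw
  set D : ℂ → ℂ →L[ℝ] ℂ := fun w =>
    (ψ' (Complex.exp w)).comp
      ((ContinuousLinearMap.toSpanSingleton ℂ (Complex.exp w)).restrictScalars ℝ) with hDdef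
  have hd : ∀ w : ℂ, w.re < 0 → HasFDerivAt (fun w => ψ (Complex.exp w)) (D w) w := by
    intro w hw
    exact (hψ _ (hmem w hw)).comp w ((Complex.hasDerivAt_exp w).hasFDerivAt.restrictScalars ℝ)
  have hI : ∀ w : ℂ, w.re < 0 →
      Complex.I • D w 1 - D w Complex.I = Complex.I * E (Complex.exp w) := by
    intro w hw
    rw [← hE _ (hmem w hw)]
    simp only [hDdef, ContinuousLinearMap.comp_apply, ContinuousLinearMap.coe_restrictScalars',
      ContinuousLinearMap.toSpanSingleton_apply, smul_eq_mul, mul_add, ← mul_assoc,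
      Complex.I_mul_I]
    ring_nf
  have hre : ∀ w ∈ uIcc a b ×ℂ uIcc (-Real.pi) Real.pi, w.re < 0 := by
    intro w hw
    have := hw.1
    rw [mem_preimage, uIcc_of_le hab] at this
    exact this.2.trans_lt hb
  have key := Complex.integral_boundary_rect_of_hasFDerivAt_real_off_countable
    (fun w => ψ (Complex.exp w)) D ⟨a, -Real.pi⟩ ⟨b, Real.pi⟩ ∅ countable_empty
    (fun w hw => (hd w (hre w hw)).continuousAt.continuousWithinAt)
    (fun w hw => hd w (by
      have := hw.1.1.2
      simp only [max_eq_right hab] at this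
      exact this.trans hb))
    (by
      have hc : ContinuousOn (fun w => Complex.I * E (Complex.exp w))
          (uIcc a b ×ℂ uIcc (-Real.pi) Real.pi) :=
        continuousOn_const.mul (hEc.comp Complex.continuous_exp.continuousOn
          fun w hw => hmem w (hre w hw))
      refine ContinuousOn.integrableOn_compact (isCompact_uIcc.reProdIm isCompact_uIcc) ?_
      exact hc.congr fun w hw => hI w (hre w hw))
  have hper : ∀ x : ℝ, Complex.exp (x + ((-Real.pi : ℝ) : ℂ) * Complex.I) =
      Complex.exp (x + (Real.pi : ℂ) * Complex.I) := by
    intro x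
    simp [Complex.exp_add, Complex.exp_neg]
  have hrhs : ∫ x in a..b, ∫ y in -Real.pi..Real.pi,
        (Complex.I • D (x + y * Complex.I) 1 - D (x + y * Complex.I) Complex.I) =
      Complex.I * ∫ t in a..b, angularIntegral E (Real.exp t) := by
    rw [← intervalIntegral.integral_const_mul]
    refine intervalIntegral.integral_congr fun x hx => ?_
    rw [uIcc_of_le hab] at hx
    simp only [angularIntegral]
    rw [← intervalIntegral.integral_const_mul]
    refine intervalIntegral.integral_congr fun y _ => ?_
    rw [hI _ (by simpa using hx.2.trans_lt hb), hexp]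
  simp only [hrhs] at key
  simp only [hper, sub_self, zero_add, hexp, smul_eq_mul] at key
  rw [← mul_sub] at key
  exact mul_left_cancel₀ Complex.I_ne_zero key

theorem hasFDerivAt_norm_rpow_of_ne_zero {w : ℂ} (hw : w ≠ 0) (q : ℝ) :
    HasFDerivAt (fun x : ℂ => ‖x‖ ^ q) ((q * ‖w‖ ^ (q - 2)) • innerSL ℝ w) w := by
  have h0 : 0 < ‖w‖ := norm_pos_iff.2 hw
  have h := (hasStrictFDerivAt_norm_sq w).hasFDerivAt.rpow_const (p := q / 2)
    (Or.inl (by positivity))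
  have e : ∀ (x : ℂ) (s : ℝ), (‖x‖ ^ 2) ^ s = ‖x‖ ^ (2 * s) := by
    intro x s
    rw [← Real.rpow_natCast, ← Real.rpow_mul (norm_nonneg x)]
    norm_num
  have hd : ((q * ‖w‖ ^ (q - 2)) • innerSL ℝ w : ℂ →L[ℝ] ℝ) =
      (q / 2 * (‖w‖ ^ 2) ^ (q / 2 - 1)) • 2 • innerSL ℝ w := by
    rw [e, ← Nat.cast_smul_eq_nsmul ℝ, smul_smul, show 2 * (q / 2 - 1) = q - 2 by ring]
    congr 1
    push_cast
    ring
  have hf : (fun x : ℂ => ‖x‖ ^ q) = fun x => (‖x‖ ^ 2) ^ (q / 2) := by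
    ext x
    rw [e, mul_div_cancel₀ _ two_ne_zero]
  rw [hd, hf]
  exact h

/-- The real derivative of `w ↦ |w|^q * conj w`. -/
def normRpowMulConjDeriv (q : ℝ) (w : ℂ) : ℂ →L[ℝ] ℂ :=
  (((q * ‖w‖ ^ (q - 2)) • innerSL ℝ w).smulRight ((starRingEnd ℂ) w)) +
    (‖w‖ ^ q) • (Complex.conjCLE : ℂ →L[ℝ] ℂ)

theorem hasFDerivAt_norm_rpow_mul_conj {q : ℝ} (hq : 0 < q) (w : ℂ) :
    HasFDerivAt (fun x : ℂ => ((‖x‖ ^ q : ℝ) : ℂ) * (starRingEnd ℂ) x)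
      (normRpowMulConjDeriv q w) w := by
  have hconj : HasFDerivAt (fun x : ℂ => (starRingEnd ℂ) x) (Complex.conjCLE : ℂ →L[ℝ] ℂ) w :=
    Complex.conjCLE.hasFDerivAt
  by_cases hw : w = 0
  · subst hw
    have hz : normRpowMulConjDeriv q 0 = 0 := by
      ext x; simp [normRpowMulConjDeriv, Real.zero_rpow hq.ne']
    rw [hz, hasFDerivAt_iff_isLittleO]
    simp only [norm_zero, Real.zero_rpow hq.ne', map_zero, mul_zero, sub_zero,
      zero_apply]
    have h1 : (fun x : ℂ => ‖x‖ ^ q) =o[𝓝 0] (fun _ => (1 : ℝ)) := by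
      rw [Asymptotics.isLittleO_one_iff]
      have : ContinuousAt (fun x : ℂ => ‖x‖ ^ q) 0 :=
        (continuous_norm.rpow_const fun _ => Or.inr hq.le).continuousAt
      simpa [ContinuousAt, Real.zero_rpow hq.ne'] using this
    have h2 : (fun x : ℂ => (starRingEnd ℂ) x) =O[𝓝 0] (fun x : ℂ => x) :=
      Asymptotics.IsBigO.of_bound 1 (Eventually.of_forall fun x => by simp)
    have h3 := h1.smul_isBigO h2
    simpa using h3
  · have h := (hasFDerivAt_norm_rpow_of_ne_zero hw q).smul hconj
    simp only [← Complex.real_smul]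
    unfold normRpowMulConjDeriv
    rw [add_comm]
    exact h

theorem continuousOn_norm_rpow {f : ℂ → ℂ} {S : Set ℂ} (hf : ContinuousOn f S) {q : ℝ}
    (hq : 0 ≤ q) : ContinuousOn (fun z => ‖f z‖ ^ q) S :=
  hf.norm.rpow_const fun _ _ => Or.inr hq

theorem hasFDerivAt_norm_rpow_comp {f : ℂ → ℂ} {p : ℝ} (hp : 1 < p) {z f' : ℂ}
    (hf : HasDerivAt f f' z) :
    HasFDerivAt (fun z => ((‖f z‖ ^ p : ℝ) : ℂ))
      (Complex.ofRealCLM.comp (((p * ‖f z‖ ^ (p - 2)) • innerSL ℝ (f z)).comp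
        ((ContinuousLinearMap.toSpanSingleton ℂ f').restrictScalars ℝ))) z :=
  Complex.ofRealCLM.hasFDerivAt.comp z
    ((hasFDerivAt_norm_rpow (f z) hp).comp z (hf.hasFDerivAt.restrictScalars ℝ))

theorem hasFDerivAt_norm_rpow_mul_conj_comp_mul {f g : ℂ → ℂ} {q : ℝ} (hq : 0 < q) {z f' g' : ℂ}
    (hf : HasDerivAt f f' z) (hg : HasDerivAt g g' z) :
    HasFDerivAt (fun z => (((‖f z‖ ^ q : ℝ) : ℂ) * (starRingEnd ℂ) (f z)) * g z)
      ((((‖f z‖ ^ q : ℝ) : ℂ) * (starRingEnd ℂ) (f z)) •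
          ((ContinuousLinearMap.toSpanSingleton ℂ g').restrictScalars ℝ) +
        g z • (normRpowMulConjDeriv q (f z)).comp
          ((ContinuousLinearMap.toSpanSingleton ℂ f').restrictScalars ℝ)) z :=
  ((hasFDerivAt_norm_rpow_mul_conj hq (f z)).comp z (hf.hasFDerivAt.restrictScalars ℝ)).mul
    (hg.hasFDerivAt.restrictScalars ℝ)

theorem inner_add_I_mul_inner (w h : ℂ) :
    ((inner ℝ w h : ℝ) : ℂ) + Complex.I * ((inner ℝ w (Complex.I * h) : ℝ) : ℂ) =
      w * (starRingEnd ℂ) h := by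
  apply Complex.ext <;> simp [Complex.inner] <;> ring

theorem norm_rpow_sub_two_mul_sq (w : ℂ) {q : ℝ} (hq : 0 < q) :
    ‖w‖ ^ (q - 2) * ‖w‖ ^ 2 = ‖w‖ ^ q := by
  rcases eq_or_ne w 0 with rfl | hw
  · simp [Real.zero_rpow hq.ne']
  · rw [← Real.rpow_natCast, ← Real.rpow_add (norm_pos_iff.2 hw)]
    norm_num

theorem normRpowMulConjDeriv_add_I_mul {q : ℝ} (hq : 0 < q) (w h : ℂ) :
    normRpowMulConjDeriv q w h + Complex.I * normRpowMulConjDeriv q w (Complex.I * h) =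
      (((q + 2) * ‖w‖ ^ q : ℝ) : ℂ) * (starRingEnd ℂ) h := by
  have h1 := inner_add_I_mul_inner w h
  have h2 : ((‖w‖ ^ (q - 2) : ℝ) : ℂ) * (w * (starRingEnd ℂ) w) = ((‖w‖ ^ q : ℝ) : ℂ) := by
    rw [Complex.mul_conj, Complex.normSq_eq_norm_sq, ← Complex.ofReal_mul,
      norm_rpow_sub_two_mul_sq w hq]
  simp only [normRpowMulConjDeriv, add_apply,
    ContinuousLinearMap.smulRight_apply, smul_apply, innerSL_apply_apply,
    ContinuousLinearEquiv.coe_coe, Complex.conjCLE_apply, Complex.real_smul, map_mul,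
    Complex.conj_I, smul_eq_mul, Complex.ofReal_mul, Complex.ofReal_add, Complex.ofReal_ofNat]
  linear_combination (q * ((‖w‖ ^ (q - 2) : ℝ) : ℂ) * (starRingEnd ℂ) w) * h1 +
    q * (starRingEnd ℂ) h * h2 - ((‖w‖ ^ q : ℝ) : ℂ) * (starRingEnd ℂ) h * Complex.I_mul_I

theorem norm_rpow_green {f : ℂ → ℂ} (hf : DifferentiableOn ℂ f unitDisk) {p : ℝ} (hp : 2 < p)
    {z : ℂ} (hz : z ∈ unitDisk) : ∃ L : ℂ →L[ℝ] ℂ,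
      HasFDerivAt (fun z => ((‖f z‖ ^ p : ℝ) : ℂ)) L z ∧
      L z + Complex.I * L (Complex.I * z) =
        p * (starRingEnd ℂ) ((((‖f z‖ ^ (p - 2) : ℝ) : ℂ) * (starRingEnd ℂ) (f z)) *
          (z * deriv f z)) := by
  have hfz := (hf.differentiableAt (Metric.isOpen_ball.mem_nhds hz)).hasDerivAt
  refine ⟨_, hasFDerivAt_norm_rpow_comp (by linarith) hfz, ?_⟩
  have h := inner_add_I_mul_inner (f z) (z * deriv f z)
  simp only [ContinuousLinearMap.comp_apply, smul_apply, innerSL_apply_apply,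
    ContinuousLinearMap.coe_restrictScalars', ContinuousLinearMap.toSpanSingleton_apply,
    Complex.ofRealCLM_apply, smul_eq_mul, Complex.ofReal_mul, map_mul, Complex.conj_conj,
    Complex.conj_ofReal, mul_assoc] at h ⊢
  linear_combination ((p : ℂ) * ((‖f z‖ ^ (p - 2) : ℝ) : ℂ)) * h

theorem norm_rpow_mul_conj_green {f : ℂ → ℂ} (hf : DifferentiableOn ℂ f unitDisk) {p : ℝ}
    (hp : 2 < p) {z : ℂ} (hz : z ∈ unitDisk) : ∃ L : ℂ →L[ℝ] ℂ,
      HasFDerivAt (fun z => (((‖f z‖ ^ (p - 2) : ℝ) : ℂ) * (starRingEnd ℂ) (f z)) *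
        (z * deriv f z)) L z ∧
      L z + Complex.I * L (Complex.I * z) =
        ((p * (‖f z‖ ^ (p - 2) * ‖z * deriv f z‖ ^ 2) : ℝ) : ℂ) := by
  have hfz := (hf.differentiableAt (Metric.isOpen_ball.mem_nhds hz)).hasDerivAt
  have hf' := ((hf.deriv Metric.isOpen_ball).differentiableAt
    (Metric.isOpen_ball.mem_nhds hz)).hasDerivAt
  refine ⟨_, hasFDerivAt_norm_rpow_mul_conj_comp_mul (by linarith) hfz
    ((hasDerivAt_id z).mul hf'), ?_⟩
  have h := normRpowMulConjDeriv_add_I_mul (show 0 < p - 2 by linarith) (f z) (z * deriv f z)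
  have h2 : (z * deriv f z) * (starRingEnd ℂ) (z * deriv f z) =
      ((‖z * deriv f z‖ ^ 2 : ℝ) : ℂ) := by
    rw [Complex.mul_conj, Complex.normSq_eq_norm_sq]
  simp only [ContinuousLinearMap.comp_apply, smul_apply, add_apply, id,
    ContinuousLinearMap.coe_restrictScalars', ContinuousLinearMap.toSpanSingleton_apply,
    smul_eq_mul, sub_add_cancel, mul_assoc] at h ⊢
  rw [Complex.ofReal_mul, Complex.ofReal_mul, ← h2]
  rw [Complex.ofReal_mul] at h
  linear_combination (z * deriv f z) * h + ((‖f z‖ ^ (p - 2) : ℝ) : ℂ) * (starRingEnd ℂ) (f z) *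
    z * (deriv f z + z * deriv (deriv f) z) * Complex.I_mul_I

theorem angularIntegral_re {ψ : ℂ → ℂ} (hψ : ContinuousOn ψ unitDisk) {r : ℝ}
    (hr : r ∈ Ioo (-1 : ℝ) 1) :
    angularIntegral (fun z => (ψ z).re) r = (angularIntegral ψ r).re := by
  have h := Complex.reCLM.intervalIntegral_comp_comm
    ((continuous_comp_circle hψ hr).intervalIntegrable (μ := volume) (-Real.pi) Real.pi)
  simpa [angularIntegral] using h

theorem angularIntegral_const_mul (c : ℝ) (φ : ℂ → ℝ) (r : ℝ) :
    angularIntegral (fun z => c * φ z) r = c * angularIntegral φ r :=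
  intervalIntegral.integral_const_mul _ _

/-- A real form of Green's theorem on an annulus: only the real part of the field is retained. -/
theorem angularIntegral_re_sub_eq {ψ E : ℂ → ℂ}
    (hψ : ∀ z ∈ unitDisk, ∃ L : ℂ →L[ℝ] ℂ, HasFDerivAt ψ L z ∧
      L z + Complex.I * L (Complex.I * z) = E z)
    (hEc : ContinuousOn E unitDisk) {a b : ℝ} (hab : a ≤ b) (hb : b < 0) :
    angularIntegral (fun z => (ψ z).re) (Real.exp b) -
        angularIntegral (fun z => (ψ z).re) (Real.exp a) =
      ∫ t in a..b, angularIntegral (fun z => (E z).re) (Real.exp t) := by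
  choose! L hL hLE using hψ
  have hc : ContinuousOn ψ unitDisk := fun z hz => (hL z hz).continuousAt.continuousWithinAt
  have hLE' : ∀ z ∈ unitDisk, L z z + Complex.I * L z (Complex.I * z) = E z := hLE
  have key := congrArg Complex.re (angularIntegral_sub_eq hL hLE' hEc hab hb)
  rw [Complex.sub_re, ← angularIntegral_re hc (exp_mem_Ioo hb),
    ← angularIntegral_re hc (exp_mem_Ioo (hab.trans_lt hb))] at key
  rw [key]
  have hi : IntervalIntegrable (fun t => angularIntegral E (Real.exp t)) volume a b := by
    refine ContinuousOn.intervalIntegrable ((continuousOn_angularIntegral_exp hEc).mono ?_)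
    rw [uIcc_of_le hab]
    exact fun t ht => ht.2.trans_lt hb
  have h := Complex.reCLM.intervalIntegral_comp_comm hi
  simp only [Complex.reCLM_apply] at h
  rw [← h]
  refine intervalIntegral.integral_congr fun t ht => ?_
  rw [uIcc_of_le hab] at ht
  exact (angularIntegral_re hEc (exp_mem_Ioo (ht.2.trans_lt hb))).symm

section HardyStein

variable {f : ℂ → ℂ} {p : ℝ}

theorem continuousOn_field (hf : DifferentiableOn ℂ f unitDisk) (hp : 2 < p) :
    ContinuousOn (fun z => (((‖f z‖ ^ (p - 2) : ℝ) : ℂ) * (starRingEnd ℂ) (f z)) *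
      (z * deriv f z)) unitDisk := fun z hz => by
  obtain ⟨L, hL, -⟩ := norm_rpow_mul_conj_green hf hp hz
  exact hL.continuousAt.continuousWithinAt

theorem continuousOn_energy (hf : DifferentiableOn ℂ f unitDisk) (hp : 2 < p) :
    ContinuousOn (fun z => ‖f z‖ ^ (p - 2) * ‖z * deriv f z‖ ^ 2) unitDisk :=
  (continuousOn_norm_rpow hf.continuousOn (by linarith)).mul
    ((continuousOn_id.mul (hf.deriv Metric.isOpen_ball).continuousOn).norm.pow 2)

theorem lintegral_Iio_energy (hf : DifferentiableOn ℂ f unitDisk) (hp : 2 < p) {b : ℝ}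
    (hb : b < 0) :
    0 ≤ angularIntegral (fun z => ((((‖f z‖ ^ (p - 2) : ℝ) : ℂ) * (starRingEnd ℂ) (f z)) *
      (z * deriv f z)).re) (Real.exp b) ∧
    ∫⁻ t in Iio b, ENNReal.ofReal (p * angularIntegral
        (fun z => ‖f z‖ ^ (p - 2) * ‖z * deriv f z‖ ^ 2) (Real.exp t)) =
      ENNReal.ofReal (angularIntegral (fun z => ((((‖f z‖ ^ (p - 2) : ℝ) : ℂ) *
        (starRingEnd ℂ) (f z)) * (z * deriv f z)).re) (Real.exp b)) := by
  have hE := continuousOn_energy hf hp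
  have hsub : ∀ a ≤ b, _ := fun a ha => angularIntegral_re_sub_eq
    (fun z hz => norm_rpow_mul_conj_green hf hp hz)
    (Complex.continuous_ofReal.comp_continuousOn (continuousOn_const.mul hE)) ha hb
  simp only [Complex.ofReal_re, angularIntegral_const_mul] at hsub
  have hlim := tendsto_angularIntegral_exp
    (Complex.continuous_re.comp_continuousOn (continuousOn_field hf hp))
  simp only [Function.comp_def, zero_mul, mul_zero, Complex.zero_re, smul_zero] at hlim
  have hnn : ∀ t, 0 ≤ p * angularIntegral
      (fun z => ‖f z‖ ^ (p - 2) * ‖z * deriv f z‖ ^ 2) (Real.exp t) := fun t =>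
    mul_nonneg (by linarith) (angularIntegral_nonneg (fun z => by positivity) _)
  constructor
  · refine le_of_tendsto hlim ?_
    filter_upwards [eventually_le_atBot b] with a ha
    rw [← sub_nonneg, hsub a ha]
    exact intervalIntegral.integral_nonneg ha fun t _ => hnn t
  · rw [lintegral_Iio_ofReal_of_tendsto ?_ (fun t _ => hnn t) hsub hlim, sub_zero]
    exact (continuousOn_const.mul (continuousOn_angularIntegral_exp hE)).mono
      fun t ht => lt_of_le_of_lt ht hb

/-- The Hardy–Stein identity in logarithmic polar coordinates. -/
theorem hardy_stein (hf : DifferentiableOn ℂ f unitDisk) (hp : 2 < p) {b : ℝ} (hb : b < 0) :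
    ENNReal.ofReal (angularIntegral (fun z => ‖f z‖ ^ p) (Real.exp b)) =
      ENNReal.ofReal (2 * Real.pi * ‖f 0‖ ^ p) + ENNReal.ofReal p *
        ∫⁻ t in Iio b, ∫⁻ τ in Iio t, ENNReal.ofReal (p * angularIntegral
          (fun z => ‖f z‖ ^ (p - 2) * ‖z * deriv f z‖ ^ 2) (Real.exp τ)) := by
  have hP := continuousOn_field hf hp
  have hsub : ∀ a ≤ b, _ := fun a ha => angularIntegral_re_sub_eq
    (fun z hz => norm_rpow_green hf hp hz)
    (continuousOn_const.mul (Complex.continuous_conj.comp_continuousOn hP)) ha hb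
  simp only [Complex.ofReal_re, Complex.re_ofReal_mul, Complex.conj_re, angularIntegral_const_mul] at hsub
  have hu : ContinuousOn (fun z => ‖f z‖ ^ p) unitDisk :=
    continuousOn_norm_rpow hf.continuousOn (by linarith)
  have hlim := tendsto_angularIntegral_exp hu
  have hnn : ∀ t ≤ b, 0 ≤ p * angularIntegral (fun z => ((((‖f z‖ ^ (p - 2) : ℝ) : ℂ) *
        (starRingEnd ℂ) (f z)) * (z * deriv f z)).re) (Real.exp t) := fun t ht =>
    mul_nonneg (by linarith) (lintegral_Iio_energy hf hp (ht.trans_lt hb)).1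
  have hcont := (continuousOn_const (c := p)).mul
    (continuousOn_angularIntegral_exp (Complex.continuous_re.comp_continuousOn hP))
  simp only [Pi.mul_def, Function.comp_def] at hcont
  have key := lintegral_Iio_ofReal_of_tendsto (hcont.mono fun t ht => lt_of_le_of_lt ht hb)
    hnn hsub hlim
  have hle : (2 * Real.pi) • ‖f 0‖ ^ p ≤ angularIntegral (fun z => ‖f z‖ ^ p) (Real.exp b) := by
    refine le_of_tendsto hlim ?_
    filter_upwards [eventually_le_atBot b] with a ha
    rw [← sub_nonneg, hsub a ha]
    exact intervalIntegral.integral_nonneg ha fun t ht => hnn t ht.2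
  rw [smul_eq_mul] at key hle
  rw [← lintegral_const_mul' _ _ ENNReal.ofReal_ne_top]
  have e : ∫⁻ t in Iio b, ENNReal.ofReal p * ∫⁻ τ in Iio t, ENNReal.ofReal (p * angularIntegral
        (fun z => ‖f z‖ ^ (p - 2) * ‖z * deriv f z‖ ^ 2) (Real.exp τ)) =
      ENNReal.ofReal (angularIntegral (fun z => ‖f z‖ ^ p) (Real.exp b) -
        2 * Real.pi * ‖f 0‖ ^ p) := by
    rw [← key]
    refine setLIntegral_congr_fun measurableSet_Iio fun t ht => ?_
    rw [(lintegral_Iio_energy hf hp (lt_trans ht hb)).2, ENNReal.ofReal_mul (by linarith)]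
  rw [e, ← ENNReal.ofReal_add (by positivity) (sub_nonneg.2 hle)]
  congr 1
  ring

end HardyStein

theorem measurable_lintegral_rpow_div (γ : ℝ) :
    Measurable fun r : ℝ => ∫⁻ s in Ioo (0 : ℝ) 1,
      ENNReal.ofReal (s ^ (γ - 1) / (1 - (1 - r ^ 2) * s)) := by
  refine Measurable.lintegral_prod_right'
    (f := fun x : ℝ × ℝ => ENNReal.ofReal (x.2 ^ (γ - 1) / (1 - (1 - x.1 ^ 2) * x.2))) ?_
  fun_prop

theorem exp_sq_eq (t : ℝ) : Real.exp t ^ 2 = Real.exp (2 * t) := by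
  rw [← Real.exp_nat_mul]
  norm_num

theorem lintegral_unitDisk_rpow_mul {f : ℂ → ℂ} {p γ : ℝ} (hf : DifferentiableOn ℂ f unitDisk)
    (hp : 2 < p) :
    ∫⁻ z in unitDisk, ENNReal.ofReal ((1 - ‖z‖ ^ 2) ^ (γ - 2) * ‖f z‖ ^ p) =
      ∫⁻ t in Iio (0 : ℝ), ENNReal.ofReal (Real.exp (2 * t) *
        (1 - Real.exp (2 * t)) ^ (γ - 2)) *
          ENNReal.ofReal (angularIntegral (fun z => ‖f z‖ ^ p) (Real.exp t)) := by
  have h := lintegral_unitDisk_eq (φ := fun z => ‖f z‖ ^ p)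
    (continuousOn_norm_rpow hf.continuousOn (by linarith)) (fun z => by positivity)
    (v := fun r => ENNReal.ofReal ((1 - r ^ 2) ^ (γ - 2))) (by fun_prop)
  convert h using 1
  · refine lintegral_congr fun z => ?_
    rw [mul_comm, ENNReal.ofReal_mul (by positivity)]
  · refine lintegral_congr fun t => ?_
    rw [exp_sq_eq, ENNReal.ofReal_mul (by positivity)]

theorem lintegral_unitDisk_energy_mul {f : ℂ → ℂ} {p γ : ℝ} (hf : DifferentiableOn ℂ f unitDisk)
    (hp : 2 < p) :
    ENNReal.ofReal (p / 2) * ∫⁻ z in unitDisk,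
        ENNReal.ofReal (‖deriv f z‖ ^ 2 * ‖f z‖ ^ (p - 2) * (1 - ‖z‖ ^ 2) ^ γ) *
          ∫⁻ s in Ioo (0 : ℝ) 1, ENNReal.ofReal (s ^ (γ - 1) / (1 - (1 - ‖z‖ ^ 2) * s)) =
      ∫⁻ σ in Iio (0 : ℝ), ENNReal.ofReal (p * angularIntegral
          (fun z => ‖f z‖ ^ (p - 2) * ‖z * deriv f z‖ ^ 2) (Real.exp σ)) *
        ∫⁻ τ in Ioo σ 0, ENNReal.ofReal ((1 - Real.exp (2 * τ)) ^ (γ - 1)) := by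
  have hf' := (hf.deriv Metric.isOpen_ball).continuousOn
  have h := lintegral_unitDisk_eq (φ := fun z => ‖f z‖ ^ (p - 2) * ‖deriv f z‖ ^ 2)
    ((continuousOn_norm_rpow hf.continuousOn (by linarith)).mul (hf'.norm.pow 2))
    (fun z => by positivity)
    (v := fun r => ENNReal.ofReal ((1 - r ^ 2) ^ γ) * ∫⁻ s in Ioo (0 : ℝ) 1,
      ENNReal.ofReal (s ^ (γ - 1) / (1 - (1 - r ^ 2) * s)))
    (Measurable.mul (by fun_prop) (measurable_lintegral_rpow_div γ))
  have hang : ∀ t : ℝ, angularIntegral (fun z => ‖f z‖ ^ (p - 2) * ‖z * deriv f z‖ ^ 2)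
      (Real.exp t) = Real.exp (2 * t) *
        angularIntegral (fun z => ‖f z‖ ^ (p - 2) * ‖deriv f z‖ ^ 2) (Real.exp t) := by
    intro t
    rw [← angularIntegral_const_mul]
    refine intervalIntegral.integral_congr fun θ _ => ?_
    simp only [norm_mul, mul_pow, sq_abs, exp_sq_eq, Complex.norm_exp_ofReal_mul_I,
      Complex.norm_real, Real.norm_eq_abs, mul_one]
    ring
  have hL : ∀ z ∈ unitDisk,
      ENNReal.ofReal (‖deriv f z‖ ^ 2 * ‖f z‖ ^ (p - 2) * (1 - ‖z‖ ^ 2) ^ γ) *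
        ∫⁻ s in Ioo (0 : ℝ) 1, ENNReal.ofReal (s ^ (γ - 1) / (1 - (1 - ‖z‖ ^ 2) * s)) =
      ENNReal.ofReal (‖f z‖ ^ (p - 2) * ‖deriv f z‖ ^ 2) * (ENNReal.ofReal ((1 - ‖z‖ ^ 2) ^ γ) *
        ∫⁻ s in Ioo (0 : ℝ) 1, ENNReal.ofReal (s ^ (γ - 1) / (1 - (1 - ‖z‖ ^ 2) * s))) := by
    intro z _
    rw [ENNReal.ofReal_mul (by positivity), mul_comm (‖deriv f z‖ ^ 2), mul_assoc]
  rw [setLIntegral_congr_fun (s := unitDisk) Metric.isOpen_ball.measurableSet hL, h,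
    ← lintegral_const_mul' _ _ ENNReal.ofReal_ne_top]
  refine setLIntegral_congr_fun measurableSet_Iio fun t ht => ?_
  rw [lintegral_Ioo_rpow_one_sub_exp ht, hang, exp_sq_eq,
    ENNReal.ofReal_mul (show 0 ≤ p by linarith), ENNReal.ofReal_mul (Real.exp_pos (2 * t)).le,
    div_eq_mul_inv p, div_eq_mul_inv _ (2 : ℝ), ENNReal.ofReal_mul (show 0 ≤ p by linarith),
    ENNReal.ofReal_mul' (show (0 : ℝ) ≤ 2⁻¹ by norm_num)]
  ring

/-- The weighted Hardy–Stein identity. -/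
theorem lintegral_weight_mul_angularIntegral {f : ℂ → ℂ} {p γ : ℝ}
    (hf : DifferentiableOn ℂ f unitDisk) (hp : 2 < p) (hγ : 1 < γ) :
    ENNReal.ofReal (γ - 1) * ∫⁻ t in Iio (0 : ℝ), ENNReal.ofReal (Real.exp (2 * t) *
        (1 - Real.exp (2 * t)) ^ (γ - 2)) *
          ENNReal.ofReal (angularIntegral (fun z => ‖f z‖ ^ p) (Real.exp t)) =
      ENNReal.ofReal (Real.pi * ‖f 0‖ ^ p) + ENNReal.ofReal (p / 2) *
        ∫⁻ σ in Iio (0 : ℝ), ENNReal.ofReal (p * angularIntegral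
            (fun z => ‖f z‖ ^ (p - 2) * ‖z * deriv f z‖ ^ 2) (Real.exp σ)) *
          ∫⁻ τ in Ioo σ 0, ENNReal.ofReal ((1 - Real.exp (2 * τ)) ^ (γ - 1)) := by
  set k : ℝ → ℝ≥0∞ := fun σ => ENNReal.ofReal (p * angularIntegral
    (fun z => ‖f z‖ ^ (p - 2) * ‖z * deriv f z‖ ^ 2) (Real.exp σ)) with hk
  set w : ℝ → ℝ≥0∞ := fun t => ENNReal.ofReal (Real.exp (2 * t) *
    (1 - Real.exp (2 * t)) ^ (γ - 2)) with hw
  have hkm : AEMeasurable k (volume.restrict (Iio 0)) :=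
    ((continuousOn_const.mul (continuousOn_angularIntegral_exp
      (continuousOn_energy hf hp))).aemeasurable measurableSet_Iio).ennreal_ofReal
  have hwm : Measurable w := by fun_prop
  have hKm : Measurable fun t : ℝ => ∫⁻ τ in Iio t, k τ :=
    (show Monotone fun t : ℝ => ∫⁻ τ in Iio t, k τ from
      fun a b hab => lintegral_mono_set (Iio_subset_Iio hab)).measurable
  have hc : ENNReal.ofReal (γ - 1) * ENNReal.ofReal (1 / (2 * (γ - 1))) = ENNReal.ofReal 2⁻¹ := by
    rw [← ENNReal.ofReal_mul (by linarith)]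
    congr 1
    have : γ - 1 ≠ 0 := by linarith
    field_simp
  have hW : ∫⁻ t in Iio (0 : ℝ), w t = ENNReal.ofReal (1 / (2 * (γ - 1))) := by
    rw [lintegral_weight_of_image measurableSet_Iio (by linarith) zero_le_one
      image_one_sub_exp_two_mul_Iio, Real.one_rpow, show γ - 2 + 1 = γ - 1 by ring]
  have hWτ : ∀ τ ∈ Iio (0 : ℝ), (∫⁻ σ in Iio τ, k σ) * ∫⁻ t in Ioo τ 0, w t =
      ENNReal.ofReal (1 / (2 * (γ - 1))) *
        (ENNReal.ofReal ((1 - Real.exp (2 * τ)) ^ (γ - 1)) * ∫⁻ σ in Iio τ, k σ) := by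
    intro τ hτ
    have h0 := one_sub_exp_two_mul_pos hτ
    rw [lintegral_weight_of_image measurableSet_Ioo (by linarith) h0.le
      image_one_sub_exp_two_mul_Ioo, show γ - 2 + 1 = γ - 1 by ring, div_eq_mul_one_div,
      ENNReal.ofReal_mul (Real.rpow_nonneg h0.le _)]
    ring
  have hN : ∀ t ∈ Iio (0 : ℝ),
      w t * ENNReal.ofReal (angularIntegral (fun z => ‖f z‖ ^ p) (Real.exp t)) =
      ENNReal.ofReal (2 * Real.pi * ‖f 0‖ ^ p) * w t +
        ENNReal.ofReal p * (w t * ∫⁻ τ in Iio t, ∫⁻ σ in Iio τ, k σ) := by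
    intro t ht
    rw [hardy_stein hf hp ht]
    ring
  rw [setLIntegral_congr_fun measurableSet_Iio hN, lintegral_add_left (hwm.const_mul _),
    lintegral_const_mul' _ _ ENNReal.ofReal_ne_top, lintegral_const_mul' _ _ ENNReal.ofReal_ne_top,
    hW, lintegral_Iio_mul_lintegral_Iio hwm.aemeasurable hKm.aemeasurable,
    setLIntegral_congr_fun measurableSet_Iio hWτ, lintegral_const_mul' _ _ ENNReal.ofReal_ne_top,
    lintegral_Iio_mul_lintegral_Iio (by fun_prop) hkm, mul_add]
  congr 1
  · rw [mul_left_comm, hc, ← ENNReal.ofReal_mul (by positivity)]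
    congr 1
    ring
  · rw [mul_left_comm, ← mul_assoc (ENNReal.ofReal (γ - 1)), hc, ← mul_assoc,
      ← ENNReal.ofReal_mul (by linarith), div_eq_mul_inv]

/-- for α ≥ -1, p > 2 and f holomorphic on 𝔻, as an identity in [0,∞],
‖f‖^p_{A^p_{(p/2)(α+2)-2}} = |f(0)|^p + (p²/4) ∫_𝔻 |f'|²|f|^{p-2}(1-|z|²)^{p(α+2)/2}
(∫₀¹ s^{p(α+2)/2-1}/(1-(1-|z|²)s) ds) dA(z). -/
theorem statement12 (α p : ℝ) (hα : -1 ≤ α) (hp : 2 < p) (f : ℂ → ℂ)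
    (hf : DifferentiableOn ℂ f unitDisk) :
    ApIntPow p (p / 2 * (α + 2) - 2) f =
      ENNReal.ofReal (‖f 0‖ ^ p) +
        ENNReal.ofReal (p ^ 2 / 4) *
          (∫⁻ z in unitDisk,
            ENNReal.ofReal
                (‖deriv f z‖ ^ 2 * ‖f z‖ ^ (p - 2) * (1 - ‖z‖ ^ 2) ^ (p * (α + 2) / 2)) *
              ∫⁻ s in Set.Ioo (0 : ℝ) 1,
                ENNReal.ofReal (s ^ (p * (α + 2) / 2 - 1) / (1 - (1 - ‖z‖ ^ 2) * s))) /
          ENNReal.ofReal Real.pi := by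
  have hγ : 1 < p / 2 * (α + 2) := by nlinarith
  rw [ApIntPow, show p * (α + 2) / 2 = p / 2 * (α + 2) by ring,
    show p / 2 * (α + 2) - 2 + 1 = p / 2 * (α + 2) - 1 by ring, lintegral_unitDisk_rpow_mul hf hp,
    lintegral_weight_mul_angularIntegral hf hp hγ, ← lintegral_unitDisk_energy_mul hf hp,
    ← mul_assoc, ← ENNReal.ofReal_mul (by linarith), ENNReal.add_div,
    ENNReal.ofReal_mul Real.pi_pos.le, mul_comm (ENNReal.ofReal Real.pi),
    ENNReal.mul_div_cancel_right (by simpa using Real.pi_pos) ENNReal.ofReal_ne_top,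
    show p / 2 * (p / 2) = p ^ 2 / 4 by ring]

end
end

section
/- Let β > 0 and t ∈ (0,1). Define H(p) := (p/2) ∫₀¹ s^{pβ/2 − 1} / (1 − ts) ds for p > 0. Then H is an increasing and concave function of p on (0, ∞); in particular, H(p) ≤ H(2) + (p−2)·H'(2) for all p > 2. -/
open MeasureTheory Set
open scoped ENNReal

noncomputable section

/-- `H(p) = (p/2) ∫₀¹ s^{pβ/2-1}/(1-ts) ds`. -/
def Hfun (β t p : ℝ) : ℝ :=
  p / 2 * ∫ s in Set.Ioo (0 : ℝ) 1, s ^ (p * β / 2 - 1) / (1 - t * s)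

/-- The integral of `s ^ (a - 1) / (1 - t s)` over `(0, 1)`, expanded as a geometric series. -/
lemma hasSum_integral_rpow_div_one_sub {t a : ℝ} (ht : t ∈ Ioo (0 : ℝ) 1) (ha : 0 < a) :
    HasSum (fun n : ℕ => t ^ n / (n + a))
      (∫ s in Ioo (0 : ℝ) 1, s ^ (a - 1) / (1 - t * s)) := by
  have hexp (n : ℕ) : -1 < (n : ℝ) + a - 1 := by
    have : (0 : ℝ) ≤ n := n.cast_nonneg
    linarith
  have hint (n : ℕ) :
      IntegrableOn (fun s : ℝ => t ^ n * s ^ ((n : ℝ) + a - 1)) (Ioo 0 1) :=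
    ((intervalIntegral.integrableOn_Ioo_rpow_iff one_pos).2 (hexp n)).const_mul _
  have hval (n : ℕ) :
      ∫ s in Ioo (0 : ℝ) 1, t ^ n * s ^ ((n : ℝ) + a - 1) = t ^ n / (n + a) := by
    have hna : (n : ℝ) + a ≠ 0 := by positivity
    rw [integral_const_mul, ← integral_Ioc_eq_integral_Ioo,
      ← intervalIntegral.integral_of_le zero_le_one, integral_rpow (Or.inl (hexp n))]
    simp [Real.zero_rpow hna, div_eq_mul_inv]
  have hnorm (n : ℕ) :
      ∫ s in Ioo (0 : ℝ) 1, ‖t ^ n * s ^ ((n : ℝ) + a - 1)‖ = t ^ n / (n + a) := by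
    rw [← hval n]
    refine setIntegral_congr_fun measurableSet_Ioo fun s hs => ?_
    have h0 := ht.1
    have h1 := hs.1
    exact Real.norm_of_nonneg (by positivity)
  have hsum : Summable fun n : ℕ => t ^ n / (n + a) := by
    refine Summable.of_nonneg_of_le (fun n => ?_) (fun n => ?_)
      ((summable_geometric_of_lt_one ht.1.le ht.2).div_const a)
    · have h0 := ht.1
      positivity
    · have h0 := ht.1
      gcongr
      linarith [(n.cast_nonneg : (0 : ℝ) ≤ n)]
  have key := hasSum_integral_of_summable_integral_norm (μ := volume.restrict (Ioo (0 : ℝ) 1))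
    hint (by simpa only [hnorm] using hsum)
  simp only [hval] at key
  suffices h : ∫ s in Ioo (0 : ℝ) 1, s ^ (a - 1) / (1 - t * s) =
      ∫ s in Ioo (0 : ℝ) 1, ∑' n : ℕ, t ^ n * s ^ ((n : ℝ) + a - 1) by rwa [h]
  refine setIntegral_congr_fun measurableSet_Ioo fun s hs => ?_
  have hts : t * s < 1 := by nlinarith [hs.1, hs.2, ht.1, ht.2]
  have hgeo := (hasSum_geometric_of_lt_one (mul_nonneg ht.1.le hs.1.le) hts).mul_left (s ^ (a - 1))
  rw [← div_eq_mul_inv] at hgeo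
  refine (hgeo.tsum_eq.symm.trans (tsum_congr fun n => ?_))
  rw [show (n : ℝ) + a - 1 = (a - 1) + n by ring, Real.rpow_add_natCast hs.1.ne', mul_pow]
  ring

lemma Hfun_hasSum {β t p : ℝ} (hβ : 0 < β) (ht : t ∈ Ioo (0 : ℝ) 1) (hp : 0 < p) :
    HasSum (fun n : ℕ => t ^ n * (p / (2 * n + β * p))) (Hfun β t p) := by
  have hpos : 0 < p * β / 2 := by positivity
  have hterm : (fun n : ℕ => t ^ n * (p / (2 * n + β * p))) =
      fun n : ℕ => p / 2 * (t ^ n / (n + p * β / 2)) := by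
    funext n
    have h1 : 2 * (n : ℝ) + β * p ≠ 0 := by positivity
    have h2 : (n : ℝ) + p * β / 2 ≠ 0 := by positivity
    field_simp
  rw [hterm]
  exact (hasSum_integral_rpow_div_one_sub ht hpos).mul_left (p / 2)

lemma norm_Hfun_deriv_term_le {β t p : ℝ} (hβ : 0 < β) (ht : t ∈ Ioo (0 : ℝ) 1) (hp : 0 < p)
    (n : ℕ) :
    ‖t ^ n * (2 * n / (2 * n + β * p) ^ 2)‖ ≤ t ^ n := by
  have h0 := ht.1
  rw [Real.norm_of_nonneg (by positivity)]
  refine mul_le_of_le_one_right (by positivity) ((div_le_one (by positivity)).2 ?_)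
  rcases Nat.eq_zero_or_pos n with rfl | hn
  · simp only [Nat.cast_zero, mul_zero]
    positivity
  · have hn' : (1 : ℝ) ≤ n := by exact_mod_cast hn
    nlinarith [mul_pos hβ hp]

lemma Hfun_hasDerivAt {β t p : ℝ} (hβ : 0 < β) (ht : t ∈ Ioo (0 : ℝ) 1) (hp : 0 < p) :
    HasDerivAt (Hfun β t) (∑' n : ℕ, t ^ n * (2 * n / (2 * n + β * p) ^ 2)) p := by
  have key := hasDerivAt_tsum_of_isPreconnected
    (g := fun (n : ℕ) (q : ℝ) => t ^ n * (q / (2 * n + β * q)))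
    (g' := fun (n : ℕ) (q : ℝ) => t ^ n * (2 * n / (2 * n + β * q) ^ 2))
    (summable_geometric_of_lt_one ht.1.le ht.2) isOpen_Ioi isPreconnected_Ioi
    (fun n q (hq : 0 < q) => by
      have hne : 2 * (n : ℝ) + β * q ≠ 0 := by positivity
      refine (((hasDerivAt_id q).div (((hasDerivAt_id q).const_mul β).const_add (2 * (n : ℝ)))
        hne).const_mul (t ^ n)).congr_deriv ?_
      simp only [id]
      ring)
    (fun n q hq => norm_Hfun_deriv_term_le hβ ht hq n) hp (Hfun_hasSum hβ ht hp).summable hp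
  refine key.congr_of_eventuallyEq ?_
  filter_upwards [Ioi_mem_nhds hp] with q hq
  exact (Hfun_hasSum hβ ht hq).tsum_eq.symm

/-- The graph of `Hfun β t` lies below each of its tangents. -/
lemma Hfun_le_tangent {β t x z : ℝ} (hβ : 0 < β) (ht : t ∈ Ioo (0 : ℝ) 1) (hx : 0 < x)
    (hz : 0 < z) : Hfun β t x ≤ Hfun β t z + (x - z) * deriv (Hfun β t) z := by
  have hd : Summable fun n : ℕ => t ^ n * (2 * n / (2 * n + β * z) ^ 2) :=
    .of_norm_bounded (summable_geometric_of_lt_one ht.1.le ht.2) (norm_Hfun_deriv_term_le hβ ht hz)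
  rw [(Hfun_hasDerivAt hβ ht hz).deriv]
  refine hasSum_le (fun n => ?_) (Hfun_hasSum hβ ht hx)
    ((Hfun_hasSum hβ ht hz).add (hd.hasSum.mul_left (x - z)))
  have h0 := ht.1
  rw [← sub_nonneg]
  have : t ^ n * (z / (2 * n + β * z)) + (x - z) * (t ^ n * (2 * n / (2 * n + β * z) ^ 2))
      - t ^ n * (x / (2 * n + β * x))
      = t ^ n * (2 * n * β * (x - z) ^ 2 / ((2 * n + β * z) ^ 2 * (2 * n + β * x))) := by
    have h1 : 2 * (n : ℝ) + β * z ≠ 0 := by positivity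
    have h2 : 2 * (n : ℝ) + β * x ≠ 0 := by positivity
    field_simp
    ring
  rw [this]
  positivity

lemma Hfun_strictMonoOn {β t : ℝ} (hβ : 0 < β) (ht : t ∈ Ioo (0 : ℝ) 1) :
    StrictMonoOn (Hfun β t) (Ioi 0) := by
  intro x (hx : 0 < x) y (hy : 0 < y) hxy
  have h0 := ht.1
  refine hasSum_lt (i := 1) (fun n => ?_) ?_ (Hfun_hasSum hβ ht hx) (Hfun_hasSum hβ ht hy)
  · refine mul_le_mul_of_nonneg_left ?_ (by positivity)
    rw [div_le_div_iff₀ (by positivity) (by positivity)]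
    nlinarith [mul_le_mul_of_nonneg_left hxy.le (n.cast_nonneg : (0 : ℝ) ≤ n)]
  · refine mul_lt_mul_of_pos_left ?_ (by positivity)
    rw [div_lt_div_iff₀ (by positivity) (by positivity)]
    push_cast
    nlinarith

lemma Hfun_concaveOn {β t : ℝ} (hβ : 0 < β) (ht : t ∈ Ioo (0 : ℝ) 1) :
    ConcaveOn ℝ (Ioi 0) (Hfun β t) := by
  refine ⟨convex_Ioi 0, fun x hx y hy a b ha hb hab => ?_⟩
  have hz := convex_Ioi (0 : ℝ) hx hy ha hb hab
  have h1 := mul_le_mul_of_nonneg_left (Hfun_le_tangent hβ ht hx hz) ha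
  have h2 := mul_le_mul_of_nonneg_left (Hfun_le_tangent hβ ht hy hz) hb
  simp only [smul_eq_mul] at h1 h2 ⊢
  obtain rfl : b = 1 - a := by linarith
  linarith

/-- for β > 0 and t ∈ (0,1), the function H is increasing and concave on
(0,∞); in particular H(p) ≤ H(2) + (p-2)·H'(2) for all p > 2. -/
theorem statement13 (β t : ℝ) (hβ : 0 < β) (ht : t ∈ Set.Ioo (0 : ℝ) 1) :
    StrictMonoOn (Hfun β t) (Set.Ioi 0) ∧
    ConcaveOn ℝ (Set.Ioi 0) (Hfun β t) ∧
    ∀ p > 2, Hfun β t p ≤ Hfun β t 2 + (p - 2) * deriv (Hfun β t) 2 := by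
  exact ⟨Hfun_strictMonoOn hβ ht, Hfun_concaveOn hβ ht, fun p hp =>
    Hfun_le_tangent hβ ht (two_pos.trans hp) two_pos⟩

end
end

section
/- Let α ≥ -1 and let k, n ≥ 1 be integers. Then B(k, n + α + 3) ≤ Γ(α+5) · (k−1)! / ((n + α + 3) · Γ(k + α + 4)), where B denotes Euler's Beta function. -/
open MeasureTheory Set

noncomputable section

/-- Euler's Beta function `B(x,y) = ∫₀¹ t^{x-1}(1-t)^{y-1} dt`. -/
def eulerBeta (x y : ℝ) : ℝ :=
  ∫ t in Set.Ioo (0 : ℝ) 1, t ^ (x - 1) * (1 - t) ^ (y - 1)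

theorem betaIntegral_ofReal_eq_eulerBeta (x y : ℝ) :
    Complex.betaIntegral x y = (eulerBeta x y : ℂ) := by
  rw [Complex.betaIntegral, intervalIntegral.integral_of_le zero_le_one,
    integral_Ioc_eq_integral_Ioo, eulerBeta, ← integral_complex_ofReal]
  refine setIntegral_congr_fun measurableSet_Ioo fun t ht => ?_
  have h : 0 ≤ 1 - t := by linarith [ht.2]
  rw [Complex.ofReal_mul, Complex.ofReal_cpow ht.1.le, Complex.ofReal_cpow h]
  push_cast
  rfl

theorem eulerBeta_eq_Gamma_mul_div {x y : ℝ} (hx : 0 < x) (hy : 0 < y) :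
    eulerBeta x y = Real.Gamma x * Real.Gamma y / Real.Gamma (x + y) := by
  have h := ProbabilityTheory.beta_eq_betaIntegralReal x y hx hy
  rw [betaIntegral_ofReal_eq_eulerBeta, Complex.ofReal_re] at h
  exact h.symm

/-- The ratio `Γ(x + m) / Γ(x)` is nondecreasing in `x > 0`. -/
theorem Gamma_mul_Gamma_add_nat_le {a b : ℝ} (ha : 0 < a) (hab : a ≤ b) (m : ℕ) :
    Real.Gamma b * Real.Gamma (a + m) ≤ Real.Gamma a * Real.Gamma (b + m) := by
  have hb : 0 < b := ha.trans_le hab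
  induction m with
  | zero => simp [mul_comm]
  | succ m ih =>
    have ham : 0 < a + m := by positivity
    have hbm : 0 < b + m := by positivity
    have hga := Real.Gamma_pos_of_pos ha
    have hgbm := Real.Gamma_pos_of_pos hbm
    push_cast
    rw [← add_assoc, ← add_assoc, Real.Gamma_add_one ham.ne', Real.Gamma_add_one hbm.ne']
    calc Real.Gamma b * ((a + m) * Real.Gamma (a + m))
        = (a + m) * (Real.Gamma b * Real.Gamma (a + m)) := by ring
      _ ≤ (b + m) * (Real.Gamma a * Real.Gamma (b + m)) := by gcongr
      _ = Real.Gamma a * ((b + m) * Real.Gamma (b + m)) := by ring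

/-- for α ≥ -1 and integers k, n ≥ 1,
B(k, n+α+3) ≤ Γ(α+5)·(k-1)!/((n+α+3)·Γ(k+α+4)). -/
theorem statement14 (α : ℝ) (hα : -1 ≤ α) (k n : ℕ) (hk : 1 ≤ k) (hn : 1 ≤ n) :
    eulerBeta (k : ℝ) ((n : ℝ) + α + 3) ≤
      Real.Gamma (α + 5) * ((k - 1).factorial : ℝ) /
        (((n : ℝ) + α + 3) * Real.Gamma ((k : ℝ) + α + 4)) := by
  have hn' : (1 : ℝ) ≤ n := by exact_mod_cast hn
  obtain ⟨m, rfl⟩ : ∃ m, k = m + 1 := ⟨k - 1, by omega⟩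
  set x : ℝ := (n : ℝ) + α + 3 with hx
  have hx0 : 0 < x := by linarith
  have hm : (0 : ℝ) ≤ m := m.cast_nonneg
  have key := Gamma_mul_Gamma_add_nat_le (a := α + 5) (b := x + 1) (by linarith) (by linarith) m
  rw [Real.Gamma_add_one hx0.ne'] at key
  rw [eulerBeta_eq_Gamma_mul_div (by positivity) hx0]
  push_cast
  rw [Real.Gamma_nat_eq_factorial,
    show (m : ℝ) + 1 + x = x + 1 + m by ring, show (m : ℝ) + 1 + α + 4 = α + 5 + m by ring]
  have h1 : 0 < Real.Gamma (x + 1 + m) := Real.Gamma_pos_of_pos (by linarith)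
  have h2 : 0 < Real.Gamma (α + 5 + m) := Real.Gamma_pos_of_pos (by linarith)
  rw [div_le_div_iff₀ h1 (mul_pos hx0 h2)]
  calc (m.factorial : ℝ) * Real.Gamma x * (x * Real.Gamma (α + 5 + m))
      = m.factorial * (x * Real.Gamma x * Real.Gamma (α + 5 + m)) := by ring
    _ ≤ m.factorial * (Real.Gamma (α + 5) * Real.Gamma (x + 1 + m)) := by gcongr
    _ = Real.Gamma (α + 5) * m.factorial * Real.Gamma (x + 1 + m) := by ring

end
end

section
/- Let α ≥ -1, p > 2 and ζ ∈ 𝔻 with ζ ≠ 0. Let K̃_ζ(z) := (1−|ζ|²)^{(α+2)/2} / (1 − conj(ζ)·z)^{α+2} be the normalized reproducing (Bergman/Szegő) kernel, which satisfies ‖K̃_ζ‖_{A²_α} = 1. Then F_p(K̃_ζ) < 1. -/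
open MeasureTheory Set Filter
open scoped ENNReal NNReal Topology

noncomputable section

theorem ccoef_pos {β : ℝ} (hβ : 0 < β) (n : ℕ) : 0 < ccoef β n := by
  unfold ccoef
  have := Real.Gamma_pos_of_pos hβ
  have := Real.Gamma_pos_of_pos (show 0 < n + β by positivity)
  positivity

theorem factorial_mul_ccoef {β : ℝ} (hβ : 0 < β) (n : ℕ) :
    n.factorial * ccoef β n = (ascPochhammer ℝ n).eval β := by
  have hΓ := (Real.Gamma_pos_of_pos hβ).ne'
  have hn : (n.factorial : ℝ) ≠ 0 := by positivity
  have key : Real.Gamma (n + β) = Real.Gamma β * (ascPochhammer ℝ n).eval β := by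
    induction n with
    | zero => simp
    | succ n ih =>
      have h : (n : ℝ) + β ≠ 0 := by positivity
      rw [ascPochhammer_succ_eval, ← mul_assoc, ← ih (by positivity), Nat.cast_succ,
        add_right_comm, Real.Gamma_add_one h]
      ring
  rw [ccoef, key]
  field_simp

theorem ringChoose_eq_ccoef {β : ℝ} (hβ : 0 < β) (n : ℕ) :
    Ring.choose ((β : ℂ) + n - 1) n = ccoef β n := by
  have hn : (n.factorial : ℝ) ≠ 0 := by positivity
  have h : (n.factorial : ℝ) * Ring.choose (β + n - 1) n = n.factorial * ccoef β n := by
    rw [factorial_mul_ccoef hβ, ← Ring.multichoose_eq, ← nsmul_eq_mul,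
      Ring.factorial_nsmul_multichoose_eq_ascPochhammer, Polynomial.ascPochhammer_smeval_eq_eval]
  rw [← mul_left_cancel₀ hn h, Complex.ofReal_choose]
  push_cast
  rfl

theorem hasSum_ccoef_mul_pow {β : ℝ} (hβ : 0 < β) {w : ℂ} (hw : ‖w‖ < 1) :
    HasSum (fun n : ℕ => (ccoef β n : ℂ) * w ^ n) (1 / (1 - w) ^ (β : ℂ)) := by
  have := (Complex.one_div_one_sub_cpow_hasFPowerSeriesOnBall_zero β).hasSum (y := w)
    (by simpa [enorm_eq_nnnorm, ← NNReal.coe_lt_one] using hw)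
  simpa [ringChoose_eq_ccoef hβ, FormalMultilinearSeries.ofScalars, mul_comm] using this

theorem hasSum_ccoef_mul_pow_real {β : ℝ} (hβ : 0 < β) {r : ℝ} (hr0 : 0 ≤ r) (hr : r < 1) :
    HasSum (fun n : ℕ => ccoef β n * r ^ n) ((1 - r) ^ (-β)) := by
  have := hasSum_ccoef_mul_pow hβ (w := r) (by simpa [abs_of_nonneg hr0] using hr)
  rw [one_div, ← Complex.cpow_neg] at this
  rw [← Complex.hasSum_ofReal, Complex.ofReal_cpow (by linarith)]
  push_cast
  exact this

theorem taylorCoeff_kernel {β : ℝ} (hβ : 0 < β) (c w : ℂ) (n : ℕ) :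
    taylorCoeff (fun z => c / (1 - w * z) ^ (β : ℂ)) n = c * (ccoef β n * w ^ n) := by
  have h := Complex.one_div_one_sub_cpow_hasFPowerSeriesOnBall_zero β
  rw [← map_zero (w • (1 : ℂ →L[ℂ] ℂ))] at h
  have h₁ := (h.compContinuousLinearMap (u := w • (1 : ℂ →L[ℂ] ℂ))).hasFPowerSeriesAt.const_smul
    (c := c)
  obtain ⟨r, h₂⟩ := h₁
  have h₃ := h₂.factorial_smul 1 n
  have hn : (n.factorial : ℂ) ≠ 0 := Nat.cast_ne_zero.mpr n.factorial_ne_zero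
  rw [taylorCoeff, iteratedDeriv_eq_iteratedFDeriv]
  have hf : (fun z => c / (1 - w * z) ^ (β : ℂ)) =
      c • ((fun x ↦ 1 / (1 - x) ^ (β:ℂ)) ∘ (w • (1 : ℂ →L[ℂ] ℂ))) := by
    ext z
    simp [div_eq_mul_inv]
  rw [hf, ← h₃]
  simp [ringChoose_eq_ccoef hβ, FormalMultilinearSeries.ofScalars,
    FormalMultilinearSeries.compContinuousLinearMap]
  field_simp

theorem integral_cexp_int (k : ℤ) :
    ∫ θ in (-Real.pi)..Real.pi, Complex.exp (k * θ * Complex.I) =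
      if k = 0 then ((2 * Real.pi : ℝ) : ℂ) else 0 := by
  split_ifs with hk
  · subst hk
    simp
    ring
  · have hc : (k : ℂ) * Complex.I ≠ 0 := by simp [hk]
    have h := integral_exp_mul_complex (a := -Real.pi) (b := Real.pi) hc
    simp_rw [mul_right_comm _ _ Complex.I]
    rw [h, div_eq_zero_iff, sub_eq_zero]
    left
    rw [Complex.exp_eq_exp_iff_exists_int]
    exact ⟨k, by push_cast; ring⟩

theorem integral_normSq_tsum_exp {a : ℕ → ℂ} (ha : Summable fun n => ‖a n‖) :
    HasSum (fun n => 2 * Real.pi * ‖a n‖ ^ 2)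
      (∫ θ in (-Real.pi)..Real.pi, ‖∑' n : ℕ, a n * Complex.exp (n * θ * Complex.I)‖ ^ 2) := by
  have hexp (n : ℕ) (θ : ℝ) : ‖Complex.exp (n * θ * Complex.I)‖ = 1 := by
    rw [← Complex.ofReal_natCast, ← Complex.ofReal_mul, Complex.norm_exp_ofReal_mul_I]
  set F : ℕ × ℕ → ℝ → ℂ := fun p θ => (a p.1 * Complex.exp (p.1 * θ * Complex.I)) *
    (starRingEnd ℂ) (a p.2 * Complex.exp (p.2 * θ * Complex.I)) with hF
  have hFnorm (p : ℕ × ℕ) (θ : ℝ) : ‖F p θ‖ = ‖a p.1‖ * ‖a p.2‖ := by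
    simp [hF, hexp]
  have hsum : Summable fun p : ℕ × ℕ => ‖a p.1‖ * ‖a p.2‖ :=
    ha.mul_of_nonneg ha (fun _ => norm_nonneg _) fun _ => norm_nonneg _
  have hs (θ : ℝ) : Summable fun n : ℕ => ‖a n * Complex.exp (n * θ * Complex.I)‖ := by
    simpa [hexp] using ha
  have hpt (θ : ℝ) : HasSum (fun p => F p θ)
      ((‖∑' n : ℕ, a n * Complex.exp (n * θ * Complex.I)‖ ^ 2 : ℝ) : ℂ) := by
    have h₁ := (hs θ).of_norm.hasSum
    have h₂ := (Complex.hasSum_conj' (x := _)).mpr h₁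
    have h₃ := h₁.mul h₂ (Summable.of_norm (by simpa only [hFnorm] using hsum : Summable fun p => ‖F p θ‖))
    rwa [Complex.mul_conj, Complex.normSq_eq_norm_sq] at h₃
  have hint := intervalIntegral.hasSum_integral_of_dominated_convergence
    (μ := volume) (a := -Real.pi) (b := Real.pi) (F := F) (fun p _ => ‖a p.1‖ * ‖a p.2‖)
    (fun p => by
      refine Continuous.aestronglyMeasurable ?_
      simp only [hF]
      fun_prop)
    (fun p => ae_of_all _ fun θ _ => (hFnorm p θ).le)
    (ae_of_all _ fun θ _ => hsum) (by simp) (ae_of_all _ fun θ _ => hpt θ)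
  rw [intervalIntegral.integral_ofReal] at hint
  have hval (p : ℕ × ℕ) : ∫ θ in (-Real.pi)..Real.pi, F p θ =
      if p.1 = p.2 then ((2 * Real.pi * ‖a p.1‖ ^ 2 : ℝ) : ℂ) else 0 := by
    have h (θ : ℝ) : F p θ = (a p.1 * (starRingEnd ℂ) (a p.2)) *
        Complex.exp (((p.1 : ℤ) - (p.2 : ℤ) : ℤ) * θ * Complex.I) := by
      simp only [hF, map_mul, ← Complex.exp_conj, Complex.conj_ofReal, Complex.conj_I, map_natCast]
      rw [mul_mul_mul_comm, ← Complex.exp_add]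
      push_cast
      ring_nf
    simp_rw [h, intervalIntegral.integral_const_mul, integral_cexp_int, sub_eq_zero, Nat.cast_inj]
    split_ifs with hp
    · rw [← hp, Complex.mul_conj, Complex.normSq_eq_norm_sq]
      push_cast
      ring
    · simp
  simp_rw [hval] at hint
  have hdiag : Function.Injective fun n : ℕ => (n, n) := fun m n h => (Prod.mk.inj h).1
  rw [← hdiag.hasSum_iff] at hint
  · simpa only [Function.comp_def, if_true, Complex.hasSum_ofReal] using hint
  · rintro ⟨m, n⟩ hmn
    rw [if_neg]
    exact fun h => hmn ⟨m, by simpa using h⟩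

theorem lintegral_kernel_circle {β : ℝ} (hβ : 0 < β) {w : ℂ} (hw : ‖w‖ < 1) :
    ∫⁻ θ in Ioo (-Real.pi) Real.pi,
        ENNReal.ofReal (‖1 - w * Complex.exp (θ * Complex.I)‖ ^ (-(2 * β))) =
      ∑' n : ℕ, ENNReal.ofReal (2 * Real.pi * (ccoef β n ^ 2 * ‖w‖ ^ (2 * n))) := by
  have hexp (θ : ℝ) : ‖w * Complex.exp (θ * Complex.I)‖ < 1 := by
    rwa [norm_mul, Complex.norm_exp_ofReal_mul_I, mul_one]
  have hne (θ : ℝ) : 1 - w * Complex.exp (θ * Complex.I) ≠ 0 := fun h => by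
    have h₁ := hexp θ
    rw [← sub_eq_zero.mp h, norm_one] at h₁
    exact lt_irrefl _ h₁
  have hsum := (hasSum_ccoef_mul_pow hβ hw).summable.norm
  have h := integral_normSq_tsum_exp hsum
  have hval (θ : ℝ) :
      ‖∑' n : ℕ, ((ccoef β n : ℂ) * w ^ n) * Complex.exp (n * θ * Complex.I)‖ ^ 2 =
        ‖1 - w * Complex.exp (θ * Complex.I)‖ ^ (-(2 * β)) := by
    have h₁ := (hasSum_ccoef_mul_pow hβ (hexp θ)).tsum_eq
    simp_rw [mul_pow, ← Complex.exp_nat_mul, ← mul_assoc] at h₁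
    rw [h₁, norm_div, norm_one, Complex.norm_cpow_real, one_div, ← Real.rpow_neg (norm_nonneg _),
      ← Real.rpow_natCast, ← Real.rpow_mul (norm_nonneg _)]
    congr 1
    push_cast
    ring
  simp_rw [hval] at h
  rw [intervalIntegral.integral_of_le (by linarith [Real.pi_pos]), integral_Ioc_eq_integral_Ioo] at h
  rw [← ofReal_integral_eq_lintegral_ofReal, ← h.tsum_eq, ENNReal.ofReal_tsum_of_nonneg
    (fun n => by positivity) h.summable]
  · refine tsum_congr fun n => ?_
    simp [mul_pow, pow_mul, pow_right_comm]
  · refine IntegrableOn.mono_set (Continuous.integrableOn_Icc ?_) Ioo_subset_Icc_self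
    exact Continuous.rpow_const (by fun_prop) fun θ => Or.inl (norm_ne_zero_iff.mpr (hne θ))
  · exact ae_of_all _ fun θ => by positivity

theorem lintegral_unitDisk_polar {f : ℂ → ℝ≥0∞} (hf : Measurable f) :
    ∫⁻ z in unitDisk, f z =
      ∫⁻ ρ in Ioo (0 : ℝ) 1, ENNReal.ofReal ρ *
        ∫⁻ θ in Ioo (-Real.pi) Real.pi, f (ρ * Complex.exp (θ * Complex.I)) := by
  have hD : MeasurableSet unitDisk := measurableSet_ball
  have hm : Measurable fun p : ℝ × ℝ => (p.1 : ℂ) * Complex.exp (p.2 * Complex.I) := by fun_prop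
  have hsymm (p : ℝ × ℝ) : Complex.polarCoord.symm p = p.1 * Complex.exp (p.2 * Complex.I) := by
    rw [Complex.polarCoord_symm_apply, Complex.exp_mul_I]
    push_cast
    rfl
  rw [← lintegral_indicator hD, ← Complex.lintegral_comp_polarCoord_symm,
    show polarCoord.target = Ioi (0 : ℝ) ×ˢ Ioo (-Real.pi) Real.pi from rfl,
    Measure.volume_eq_prod, ← Measure.prod_restrict]
  simp_rw [hsymm, smul_eq_mul]
  have hmeas : Measurable fun p : ℝ × ℝ => ENNReal.ofReal p.1 *
      unitDisk.indicator f (p.1 * Complex.exp (p.2 * Complex.I)) :=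
    (by fun_prop : Measurable fun p : ℝ × ℝ => ENNReal.ofReal p.1).mul
      ((hf.indicator hD).comp hm)
  rw [lintegral_prod _ hmeas.aemeasurable, 
    show Ioo (0 : ℝ) 1 = Iio 1 ∩ Ioi 0 by rw [inter_comm, Ioi_inter_Iio],
    ← Measure.restrict_restrict measurableSet_Iio,
    ← lintegral_indicator measurableSet_Iio]
  refine setLIntegral_congr_fun measurableSet_Ioi fun ρ hρ => ?_
  have hρ' : 0 < ρ := hρ
  have hmem (θ : ℝ) : (ρ * Complex.exp (θ * Complex.I) : ℂ) ∈ unitDisk ↔ ρ < 1 := by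
    simp [unitDisk, Complex.norm_exp_ofReal_mul_I, abs_of_pos hρ']
  by_cases h : ρ < 1
  · simp only [indicator, hmem, h, if_true, mem_Iio]
    rw [lintegral_const_mul]
    exact hf.comp (by fun_prop)
  · simp only [indicator, hmem, h, if_false, mem_Iio, mul_zero, lintegral_zero]

theorem lintegral_kernel_mul_radial {β : ℝ} (hβ : 0 < β) {w : ℂ} (hw : ‖w‖ < 1) {Φ : ℝ → ℝ≥0∞}
    (hΦ : Measurable Φ) :
    ∫⁻ z in unitDisk, ENNReal.ofReal (‖1 - w * z‖ ^ (-(2 * β))) * Φ ‖z‖ =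
      ∑' n : ℕ, ENNReal.ofReal (2 * Real.pi * (ccoef β n ^ 2 * ‖w‖ ^ (2 * n))) *
        ∫⁻ ρ in Ioo (0 : ℝ) 1, ENNReal.ofReal (ρ ^ (2 * n + 1)) * Φ ρ := by
  have hmeas' : Measurable fun z : ℂ => ENNReal.ofReal (‖1 - w * z‖ ^ (-(2 * β))) * Φ ‖z‖ :=
    (by fun_prop : Measurable fun z : ℂ => ENNReal.ofReal (‖1 - w * z‖ ^ (-(2 * β)))).mul
      (hΦ.comp measurable_norm)
  rw [lintegral_unitDisk_polar hmeas']
  have hmeas (n : ℕ) : Measurable fun ρ : ℝ => ENNReal.ofReal (ρ ^ (2 * n + 1)) * Φ ρ :=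
    (by fun_prop : Measurable fun ρ : ℝ => ENNReal.ofReal (ρ ^ (2 * n + 1))).mul hΦ
  simp_rw [← lintegral_const_mul _ (hmeas _)]
  rw [← lintegral_tsum fun n => ((hmeas n).const_mul _).aemeasurable]
  refine setLIntegral_congr_fun measurableSet_Ioo fun ρ hρ => ?_
  have hρw : ‖w * ρ‖ < 1 := by
    rw [norm_mul, Complex.norm_real, Real.norm_of_nonneg hρ.1.le]
    nlinarith [norm_nonneg w, hρ.1, hρ.2]
  have hnorm (θ : ℝ) : ‖(ρ : ℂ) * Complex.exp (θ * Complex.I)‖ = ρ := by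
    simp [Complex.norm_exp_ofReal_mul_I, abs_of_pos hρ.1]
  simp only [hnorm, ← mul_assoc w]
  rw [lintegral_mul_const _ (by fun_prop), lintegral_kernel_circle hβ hρw, ← mul_assoc,
    ← ENNReal.tsum_mul_left, ← ENNReal.tsum_mul_right]
  refine tsum_congr fun n => ?_
  rw [← ENNReal.ofReal_mul hρ.1.le, ← mul_assoc (ENNReal.ofReal _) (ENNReal.ofReal _),
    ← ENNReal.ofReal_mul (by have := hρ.1; positivity), norm_mul,
    Complex.norm_real, Real.norm_of_nonneg hρ.1.le]
  congr 2
  ring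

/-- The integral `∫₀¹ s^(b-1)/(1-xs) ds`, valued in `[0,∞]`. -/
def radialWeight (b x : ℝ) : ℝ≥0∞ :=
  ∫⁻ s in Ioo (0 : ℝ) 1, ENNReal.ofReal (s ^ (b - 1) / (1 - x * s))

theorem setLIntegral_Ioo_ofReal {f : ℝ → ℝ} {a b : ℝ} (hab : a ≤ b)
    (hf : ContinuousOn f (Icc a b)) (h0 : ∀ s ∈ Ioo a b, 0 ≤ f s) :
    ∫⁻ s in Ioo a b, ENNReal.ofReal (f s) = ENNReal.ofReal (∫ s in a..b, f s) := by
  rw [intervalIntegral.integral_of_le hab, integral_Ioc_eq_integral_Ioo,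
    ofReal_integral_eq_lintegral_ofReal]
  · exact hf.integrableOn_Icc.mono_set Ioo_subset_Icc_self
  · exact ae_restrict_of_forall_mem measurableSet_Ioo h0

theorem continuousOn_weight {b x : ℝ} (hb : 1 ≤ b) (hx0 : 0 ≤ x) (hx : x < 1) :
    ContinuousOn (fun s : ℝ => s ^ (b - 1) / (1 - x * s)) (Icc 0 1) := by
  refine ContinuousOn.div (Continuous.continuousOn ?_) (by fun_prop) fun s hs => ?_
  · exact Real.continuous_rpow_const (by linarith)
  · nlinarith [hs.1, hs.2]

theorem radialWeight_eq {b x : ℝ} (hb : 1 ≤ b) (hx0 : 0 ≤ x) (hx : x < 1) :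
    radialWeight b x = ENNReal.ofReal (∫ s in (0 : ℝ)..1, s ^ (b - 1) / (1 - x * s)) := by
  refine setLIntegral_Ioo_ofReal zero_le_one (continuousOn_weight hb hx0 hx) fun s hs => ?_
  have := hs.1
  have : 0 < 1 - x * s := by nlinarith [hs.1, hs.2]
  positivity

theorem mul_radialWeight_lt {b q x : ℝ} (hb : 1 ≤ b) (hbq : b < q) (hx0 : 0 < x) (hx : x < 1) :
    ENNReal.ofReal b * radialWeight b x < ENNReal.ofReal q * radialWeight q x := by
  have hq : 1 ≤ q := hb.trans hbq.le
  have hpos (s : ℝ) (hs : s ∈ Icc (0 : ℝ) 1) : 0 < 1 - x * s := by nlinarith [hs.1, hs.2]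
  have hint (c : ℝ) (hc : 1 ≤ c) :
      IntervalIntegrable (fun s : ℝ => s ^ (c - 1) / (1 - x * s)) volume 0 1 := by
    refine ContinuousOn.intervalIntegrable ?_
    rw [uIcc_of_le zero_le_one]
    exact continuousOn_weight hc hx0.le hx
  have hcont : ContinuousOn (fun s : ℝ => x * (s ^ b - s ^ q) / (1 - x * s) ^ 2) (Icc 0 1) := by
    refine ContinuousOn.div (Continuous.continuousOn ?_) (by fun_prop) fun s hs => ?_
    · exact continuous_const.mul ((Real.continuous_rpow_const (by linarith)).sub
        (Real.continuous_rpow_const (by linarith)))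
    · exact pow_ne_zero _ (hpos s hs).ne'
  have hrem : 0 < ∫ s in (0 : ℝ)..1, x * (s ^ b - s ^ q) / (1 - x * s) ^ 2 := by
    refine intervalIntegral.intervalIntegral_pos_of_pos_on (hcont.intervalIntegrable_of_Icc zero_le_one)
      (fun s hs => ?_) zero_lt_one
    have := Real.rpow_lt_rpow_of_exponent_gt hs.1 hs.2 hbq
    have := hpos s (Ioo_subset_Icc_self hs)
    have : 0 < s ^ b - s ^ q := by linarith
    positivity
  have hftc : ∫ s in (0 : ℝ)..1, (b * (s ^ (b - 1) / (1 - x * s)) - q * (s ^ (q - 1) / (1 - x * s))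
      + x * (s ^ b - s ^ q) / (1 - x * s) ^ 2) = 0 := by
    rw [intervalIntegral.integral_eq_sub_of_hasDerivAt
      (f := fun s : ℝ => (s ^ b - s ^ q) / (1 - x * s))]
    · simp [Real.zero_rpow (show b ≠ 0 by linarith), Real.zero_rpow (show q ≠ 0 by linarith)]
    · intro s hs
      rw [uIcc_of_le zero_le_one] at hs
      have h := hpos s hs
      have h₁ := ((Real.hasDerivAt_rpow_const (x := s) (p := b) (Or.inr hb)).sub
        (Real.hasDerivAt_rpow_const (x := s) (p := q) (Or.inr hq))).div
        (((hasDerivAt_id s).const_mul x).const_sub 1) h.ne'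
      convert! h₁ using 1
      simp only [id]
      field_simp
      simp
    · exact (((hint b hb).const_mul b).sub ((hint q hq).const_mul q)).add
        (hcont.intervalIntegrable_of_Icc zero_le_one)
  rw [intervalIntegral.integral_add (((hint b hb).const_mul b).sub ((hint q hq).const_mul q))
    (hcont.intervalIntegrable_of_Icc zero_le_one),
    intervalIntegral.integral_sub ((hint b hb).const_mul b) ((hint q hq).const_mul q),
    intervalIntegral.integral_const_mul, intervalIntegral.integral_const_mul] at hftc
  have hnonneg : 0 ≤ ∫ s in (0 : ℝ)..1, s ^ (b - 1) / (1 - x * s) :=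
    intervalIntegral.integral_nonneg zero_le_one fun s hs =>
      div_nonneg (Real.rpow_nonneg hs.1 _) (hpos s hs).le
  rw [radialWeight_eq hb hx0.le hx, radialWeight_eq hq hx0.le hx,
    ← ENNReal.ofReal_mul (by linarith), ← ENNReal.ofReal_mul (by linarith),
    ENNReal.ofReal_lt_ofReal_iff_of_nonneg (by positivity)]
  linarith

theorem rpow_mul_radialWeight {q x : ℝ} (hq : 1 ≤ q) (hx0 : 0 < x) (hx : x < 1) :
    ENNReal.ofReal (x ^ q) * radialWeight q x =
      ∫⁻ u in Ioo 0 x, ENNReal.ofReal (u ^ (q - 1) / (1 - u)) := by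
  rw [radialWeight_eq hq hx0.le hx, ← ENNReal.ofReal_mul (by positivity),
    setLIntegral_Ioo_ofReal hx0.le]
  · have h := intervalIntegral.mul_integral_comp_mul_left (a := 0) (b := 1)
      (f := fun u : ℝ => u ^ (q - 1) / (1 - u)) x
    simp only [mul_zero, mul_one] at h
    rw [← h, show x ^ q = x * x ^ (q - 1) by
      rw [← Real.rpow_one_add' hx0.le (by linarith)]; ring_nf,
      mul_assoc, ← intervalIntegral.integral_const_mul]
    congr 2
    refine intervalIntegral.integral_congr fun s hs => ?_
    rw [uIcc_of_le zero_le_one] at hs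
    rw [Real.mul_rpow hx0.le hs.1, mul_div_assoc]
  · refine ContinuousOn.div (Continuous.continuousOn ?_) (by fun_prop) fun s hs => ?_
    · exact Real.continuous_rpow_const (by linarith)
    · linarith [hs.2]
  · intro s hs
    have := hs.1
    have : 0 < 1 - s := by linarith [hs.2]
    positivity

theorem lintegral_pow_mul_radialWeight {q : ℝ} (hq : 1 ≤ q) (n : ℕ) :
    ∫⁻ ρ in Ioo (0 : ℝ) 1, ENNReal.ofReal (ρ ^ (2 * n + 1)) *
        (ENNReal.ofReal ((1 - ρ ^ 2) ^ q) * radialWeight q (1 - ρ ^ 2)) =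
      ENNReal.ofReal (ProbabilityTheory.beta q (n + 1) / (2 * (n + 1))) := by
  have hbeta : 0 < ProbabilityTheory.beta q (n + 1) :=
    ProbabilityTheory.beta_pos (by linarith) (by positivity)
  set W : ℝ → ℝ≥0∞ := fun u => ENNReal.ofReal (u ^ (q - 1) / (1 - u)) with hW
  have hWm : Measurable W := by fun_prop
  have hS : MeasurableSet {p : ℝ × ℝ | p.2 < 1 - p.1 ^ 2} :=
    measurableSet_lt (by fun_prop) (by fun_prop)
  have hleft : ∀ ρ ∈ Ioo (0 : ℝ) 1, ENNReal.ofReal (ρ ^ (2 * n + 1)) *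
        (ENNReal.ofReal ((1 - ρ ^ 2) ^ q) * radialWeight q (1 - ρ ^ 2)) =
      ∫⁻ u in Ioo (0 : ℝ) 1, {p : ℝ × ℝ | p.2 < 1 - p.1 ^ 2}.indicator
        (fun p => ENNReal.ofReal (p.1 ^ (2 * n + 1)) * W p.2) (ρ, u) := by
    intro ρ hρ
    rw [rpow_mul_radialWeight hq (by nlinarith [hρ.1, hρ.2]) (by nlinarith [hρ.1, hρ.2]),
      ← lintegral_const_mul _ hWm]
    have : Ioo 0 (1 - ρ ^ 2) = Iio (1 - ρ ^ 2) ∩ Ioo 0 1 := by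
      ext u
      simp only [mem_Ioo, mem_inter_iff, mem_Iio]
      have := sq_nonneg ρ
      constructor
      · exact fun h => ⟨h.2, h.1, by linarith [h.2]⟩
      · exact fun h => ⟨h.2.1, h.1⟩
    rw [this, ← Measure.restrict_restrict measurableSet_Iio, ← lintegral_indicator measurableSet_Iio]
    rfl
  have hright : ∀ u ∈ Ioo (0 : ℝ) 1, ∫⁻ ρ in Ioo (0 : ℝ) 1,
      {p : ℝ × ℝ | p.2 < 1 - p.1 ^ 2}.indicator
        (fun p => ENNReal.ofReal (p.1 ^ (2 * n + 1)) * W p.2) (ρ, u) =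
      ENNReal.ofReal (ProbabilityTheory.beta q (n + 1) / (2 * (n + 1))) *
        ENNReal.ofReal (1 / ProbabilityTheory.beta q (n + 1) * u ^ (q - 1) *
          (1 - u) ^ ((n + 1 : ℝ) - 1)) := by
    intro u hu
    have hu1 : 0 < 1 - u := by linarith [hu.2]
    have hu0 := hu.1
    have hset : Ioo 0 (√(1 - u)) = Iio (√(1 - u)) ∩ Ioo 0 1 := by
      have : √(1 - u) ≤ 1 := Real.sqrt_le_one.mpr (by linarith)
      ext ρ
      simp only [mem_Ioo, mem_inter_iff, mem_Iio]
      constructor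
      · exact fun h => ⟨h.2, h.1, by linarith [h.2]⟩
      · exact fun h => ⟨h.2.1, h.1⟩
    have h₁ : ∫⁻ ρ in Ioo 0 (√(1 - u)), ENNReal.ofReal (ρ ^ (2 * n + 1)) =
        ENNReal.ofReal ((1 - u) ^ (n + 1) / (2 * (n + 1))) := by
      rw [setLIntegral_Ioo_ofReal (Real.sqrt_nonneg _) (by fun_prop)
        fun s hs => pow_nonneg hs.1.le _, integral_pow, show 2 * n + 1 + 1 = 2 * (n + 1) by ring,
        pow_mul, Real.sq_sqrt hu1.le]
      congr 1
      simp
      ring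
    have h₂ : ∀ ρ ∈ Ioo (0 : ℝ) 1, {p : ℝ × ℝ | p.2 < 1 - p.1 ^ 2}.indicator
        (fun p => ENNReal.ofReal (p.1 ^ (2 * n + 1)) * W p.2) (ρ, u) =
        (Iio (√(1 - u))).indicator (fun ρ => ENNReal.ofReal (ρ ^ (2 * n + 1)) * W u) ρ := by
      intro ρ hρ
      have : u < 1 - ρ ^ 2 ↔ ρ < √(1 - u) := by
        rw [Real.lt_sqrt hρ.1.le]
        constructor <;> intro h <;> linarith
      simp only [indicator, mem_ofPred_eq, mem_Iio, this]
    rw [setLIntegral_congr_fun measurableSet_Ioo h₂, lintegral_indicator measurableSet_Iio,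
      Measure.restrict_restrict measurableSet_Iio, ← hset, lintegral_mul_const _ (by fun_prop), h₁,
      hW, ← ENNReal.ofReal_mul (by positivity), ← ENNReal.ofReal_mul (by positivity)]
    congr 1
    rw [add_sub_cancel_right, Real.rpow_natCast]
    field_simp
    ring
  rw [setLIntegral_congr_fun measurableSet_Ioo hleft, lintegral_lintegral_swap,
    setLIntegral_congr_fun measurableSet_Ioo hright, lintegral_const_mul _ (by fun_prop),
    ← ProbabilityTheory.lintegral_betaPDF, ProbabilityTheory.lintegral_betaPDF_eq_one (by linarith)
    (by positivity), mul_one]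
  exact (Measurable.indicator (by fun_prop) hS).aemeasurable

theorem measurable_radialWeight (b : ℝ) : Measurable (radialWeight b) := by
  refine Measurable.lintegral_prod_right' (f := fun p : ℝ × ℝ =>
    ENNReal.ofReal (p.2 ^ (b - 1) / (1 - p.1 * p.2))) ?_
  fun_prop

theorem Hinner_eq_radialWeight (α : ℝ) (z : ℂ) :
    Hinner α z = radialWeight (α + 2) (1 - ‖z‖ ^ 2) := by
  rw [Hinner, radialWeight, show α + 2 - 1 = α + 1 by ring]

/-- The weighted area integral appearing in `Ffun` for a reproducing kernel, without its constant
factor. -/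
def kernelIntegral (q b : ℝ) (w : ℂ) : ℝ≥0∞ :=
  ∫⁻ z in unitDisk, ENNReal.ofReal (‖1 - w * z‖ ^ (-(2 * (q + 1)))) *
    (ENNReal.ofReal ((1 - ‖z‖ ^ 2) ^ q) * radialWeight b (1 - ‖z‖ ^ 2))

theorem measurable_kernelIntegrand (q b : ℝ) (w : ℂ) :
    Measurable fun z : ℂ => ENNReal.ofReal (‖1 - w * z‖ ^ (-(2 * (q + 1)))) *
      (ENNReal.ofReal ((1 - ‖z‖ ^ 2) ^ q) * radialWeight b (1 - ‖z‖ ^ 2)) := by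
  have := measurable_radialWeight b
  fun_prop

theorem ccoef_mul_beta {q : ℝ} (hq : 0 < q) (n : ℕ) :
    ccoef (q + 1) n * ProbabilityTheory.beta q (n + 1) = 1 / q := by
  have h₁ := (Real.Gamma_pos_of_pos hq).ne'
  have h₂ := (Real.Gamma_pos_of_pos (show 0 < n + (q + 1) by positivity)).ne'
  have hn : (n.factorial : ℝ) ≠ 0 := by positivity
  rw [ccoef, ProbabilityTheory.beta, Real.Gamma_nat_eq_factorial, Real.Gamma_add_one hq.ne',
    show q + (n + 1) = n + (q + 1) by ring]
  field_simp

theorem mul_ccoef_add_one {q : ℝ} (hq : 0 < q) (n : ℕ) :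
    q * ccoef (q + 1) n = (n + 1) * ccoef q (n + 1) := by
  have h₁ := (Real.Gamma_pos_of_pos hq).ne'
  have hn : (n.factorial : ℝ) ≠ 0 := by positivity
  rw [ccoef, ccoef, Real.Gamma_add_one hq.ne', Nat.factorial_succ]
  push_cast
  rw [show (n : ℝ) + 1 + q = n + (q + 1) by ring]
  field_simp

theorem mul_kernelIntegral_self {q : ℝ} (hq : 1 ≤ q) {w : ℂ} (hw : ‖w‖ < 1) :
    ENNReal.ofReal (q ^ 2 * ‖w‖ ^ 2) * kernelIntegral q q w =
      ENNReal.ofReal (Real.pi * ((1 - ‖w‖ ^ 2) ^ (-q) - 1)) := by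
  have hq0 : 0 < q := by linarith
  have hr : ‖w‖ ^ 2 < 1 := by nlinarith [norm_nonneg w]
  have hΦ : Measurable fun ρ : ℝ =>
      ENNReal.ofReal ((1 - ρ ^ 2) ^ q) * radialWeight q (1 - ρ ^ 2) := by
    have := measurable_radialWeight q
    fun_prop
  have hsum := (hasSum_nat_add_iff' 1).mpr (hasSum_ccoef_mul_pow_real hq0 (sq_nonneg ‖w‖) hr)
  have h0 : ccoef q 0 = 1 := by
    have h₁ := (Real.Gamma_pos_of_pos hq0).ne'
    simp [ccoef, h₁]
  simp only [Finset.range_one, Finset.sum_singleton, pow_zero, mul_one, h0] at hsum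
  rw [kernelIntegral, lintegral_kernel_mul_radial (by linarith) hw hΦ,
    ← (hsum.mul_left Real.pi).tsum_eq, ENNReal.ofReal_tsum_of_nonneg
      (fun n => by have := (ccoef_pos hq0 (n + 1)).le; positivity) (hsum.mul_left _).summable,
    ← ENNReal.tsum_mul_left]
  refine tsum_congr fun n => ?_
  rw [lintegral_pow_mul_radialWeight hq, ← ENNReal.ofReal_mul (by positivity),
    ← ENNReal.ofReal_mul (by positivity)]
  congr 1
  have h₁ := ccoef_mul_beta hq0 n
  have h₂ := mul_ccoef_add_one hq0 n
  have h₃ : ccoef (q + 1) n * (ccoef (q + 1) n * ProbabilityTheory.beta q (n + 1)) * q ^ 2 =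
      (n + 1) * ccoef q (n + 1) := by
    rw [h₁, ← h₂]
    field_simp
  calc _ = Real.pi * ‖w‖ ^ (2 * (n + 1)) * (ccoef (q + 1) n *
        (ccoef (q + 1) n * ProbabilityTheory.beta q (n + 1)) * q ^ 2) / (n + 1) := by
        field_simp
        ring
    _ = _ := by
      rw [h₃, pow_mul]
      field_simp

theorem kernelIntegral_self_ne_top {q : ℝ} (hq : 1 ≤ q) {w : ℂ} (hw : ‖w‖ < 1) (hw0 : w ≠ 0) :
    kernelIntegral q q w ≠ ∞ := by
  intro h
  have h₁ := mul_kernelIntegral_self hq hw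
  have h₂ : 0 < q ^ 2 * ‖w‖ ^ 2 := by
    have := norm_pos_iff.mpr hw0
    positivity
  rw [h, ENNReal.mul_top (by simpa using h₂)] at h₁
  exact ENNReal.ofReal_ne_top h₁.symm

theorem mul_kernelIntegral_lt {q b : ℝ} (hb : 1 ≤ b) (hbq : b < q) {w : ℂ} (hw : ‖w‖ < 1)
    (hw0 : w ≠ 0) :
    ENNReal.ofReal b * kernelIntegral q b w < ENNReal.ofReal q * kernelIntegral q q w := by
  have hq := hb.trans hbq.le
  have hlt : ∀ᵐ z : ℂ, z ∈ unitDisk →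
      ENNReal.ofReal b * (ENNReal.ofReal (‖1 - w * z‖ ^ (-(2 * (q + 1)))) *
        (ENNReal.ofReal ((1 - ‖z‖ ^ 2) ^ q) * radialWeight b (1 - ‖z‖ ^ 2))) <
      ENNReal.ofReal q * (ENNReal.ofReal (‖1 - w * z‖ ^ (-(2 * (q + 1)))) *
        (ENNReal.ofReal ((1 - ‖z‖ ^ 2) ^ q) * radialWeight q (1 - ‖z‖ ^ 2))) := by
    have hae : ∀ᵐ z : ℂ, z ≠ 0 := compl_mem_ae_iff.mpr (measure_singleton 0)
    filter_upwards [hae] with z hz0 hz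
    have hz1 : ‖z‖ < 1 := by simpa [unitDisk] using hz
    have hzpos := norm_pos_iff.mpr hz0
    have hx : 0 < 1 - ‖z‖ ^ 2 := by nlinarith
    have hwz : 0 < ‖1 - w * z‖ := by
      rw [norm_pos_iff, sub_ne_zero]
      intro h
      have := congrArg norm h
      rw [norm_one, norm_mul] at this
      nlinarith [norm_nonneg w]
    have h := mul_radialWeight_lt hb hbq hx (by nlinarith)
    rw [mul_left_comm, mul_left_comm (ENNReal.ofReal b), mul_left_comm (ENNReal.ofReal q),
      mul_left_comm (ENNReal.ofReal q)]
    refine ENNReal.mul_lt_mul_right ?_ ENNReal.ofReal_ne_top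
      (ENNReal.mul_lt_mul_right ?_ ENNReal.ofReal_ne_top h)
    · simpa using Real.rpow_pos_of_pos hwz _
    · simpa using Real.rpow_pos_of_pos hx _
  have hD : MeasurableSet unitDisk := measurableSet_ball
  have hfin : ENNReal.ofReal q * kernelIntegral q q w ≠ ∞ :=
    ENNReal.mul_ne_top ENNReal.ofReal_ne_top (kernelIntegral_self_ne_top hq hw hw0)
  unfold kernelIntegral at hfin ⊢
  rw [← lintegral_const_mul _ (measurable_kernelIntegrand q q w)] at hfin ⊢
  rw [← lintegral_const_mul _ (measurable_kernelIntegrand q b w)]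
  refine setLIntegral_strict_mono hD (Metric.measure_ball_pos volume _ one_pos).ne'
    ((measurable_kernelIntegrand q q w).const_mul _) (ne_top_of_le_ne_top hfin ?_) hlt
  exact lintegral_mono_ae ((ae_restrict_iff' hD).mpr (hlt.mono fun z h hz => (h hz).le))

theorem norm_deriv_kernel (β c : ℝ) {w z : ℂ} (hwz : ‖w * z‖ < 1) :
    ‖deriv (fun z : ℂ => (c : ℂ) / (1 - w * z) ^ (β : ℂ)) z‖ =
      |c| * |β| * ‖w‖ * ‖1 - w * z‖ ^ (-β - 1) := by
  have hslit : 1 - w * z ∈ Complex.slitPlane := by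
    rw [sub_eq_add_neg]
    exact Complex.mem_slitPlane_of_norm_lt_one (by rwa [norm_neg])
  have h := ((((hasDerivAt_id z).const_mul w).const_sub 1).cpow_const (c := -(β : ℂ))
    hslit).const_mul (c : ℂ)
  simp_rw [div_eq_mul_inv, ← Complex.cpow_neg]
  simp only [id] at h
  rw [h.deriv]
  have hexp : -(β : ℂ) - 1 = ((-β - 1 : ℝ) : ℂ) := by push_cast; ring
  simp only [hexp, norm_mul, Complex.norm_cpow_real, norm_neg, Complex.norm_real, norm_one,
    Real.norm_eq_abs]
  ring

theorem A2norm_kernel {α : ℝ} (hα : -2 < α) {w : ℂ} (hw : ‖w‖ < 1) :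
    A2norm α (fun z : ℂ => (((1 - ‖w‖ ^ 2) ^ ((α + 2) / 2) : ℝ) : ℂ) /
      (1 - w * z) ^ ((α + 2 : ℝ) : ℂ)) = 1 := by
  have hb : 0 < α + 2 := by linarith
  have hr : 0 < 1 - ‖w‖ ^ 2 := by nlinarith [norm_nonneg w]
  have hsum := (hasSum_ccoef_mul_pow_real hb (sq_nonneg ‖w‖) (by linarith)).mul_left
    ((1 - ‖w‖ ^ 2) ^ (α + 2))
  rw [← Real.rpow_add hr, add_neg_cancel, Real.rpow_zero] at hsum
  have hsq : A2normSq α (fun z : ℂ => (((1 - ‖w‖ ^ 2) ^ ((α + 2) / 2) : ℝ) : ℂ) /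
      (1 - w * z) ^ ((α + 2 : ℝ) : ℂ)) = ∑' n : ℕ, ENNReal.ofReal
        ((1 - ‖w‖ ^ 2) ^ (α + 2) * (ccoef (α + 2) n * (‖w‖ ^ 2) ^ n)) := by
    refine tsum_congr fun n => ?_
    have hc := ccoef_pos hb n
    rw [taylorCoeff_kernel hb, norm_mul, norm_mul, norm_pow, Complex.norm_real, Complex.norm_real,
      Real.norm_of_nonneg (by positivity), Real.norm_of_nonneg hc.le, mul_pow,
      ← Real.rpow_natCast, ← Real.rpow_mul hr.le]
    congr 1
    rw [show (α + 2) / 2 * ((2 : ℕ) : ℝ) = α + 2 by push_cast; ring]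
    field_simp
    ring
  rw [A2norm, hsq, ← ENNReal.ofReal_tsum_of_nonneg
    (fun n => by have := (ccoef_pos hb n).le; positivity) hsum.summable, hsum.tsum_eq,
    ENNReal.ofReal_one, ENNReal.one_rpow]

theorem Ffun_kernel (α p : ℝ) {w : ℂ} (hw : ‖w‖ < 1) :
    Ffun α p (fun z : ℂ => (((1 - ‖w‖ ^ 2) ^ ((α + 2) / 2) : ℝ) : ℂ) /
        (1 - w * z) ^ ((α + 2 : ℝ) : ℂ)) =
      ENNReal.ofReal ((1 - ‖w‖ ^ 2) ^ (p * (α + 2) / 2)) +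
        ENNReal.ofReal (p / 2) * (ENNReal.ofReal
          ((α + 2) ^ 2 * ‖w‖ ^ 2 * (1 - ‖w‖ ^ 2) ^ (p * (α + 2) / 2)) *
          kernelIntegral (p * (α + 2) / 2) (α + 2) w) / ENNReal.ofReal Real.pi := by
  have hr : 0 < 1 - ‖w‖ ^ 2 := by nlinarith [norm_nonneg w]
  have hD : MeasurableSet unitDisk := measurableSet_ball
  rw [Ffun, kernelIntegral, ← lintegral_const_mul _ (measurable_kernelIntegrand _ _ w)]
  congr 2
  · rw [mul_zero, sub_zero, Complex.one_cpow, div_one, Complex.norm_real,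
      Real.norm_of_nonneg (by positivity), ← Real.rpow_mul hr.le]
    ring_nf
  · congr 1
    refine setLIntegral_congr_fun hD fun z hz => ?_
    have hz1 : ‖z‖ < 1 := by simpa [unitDisk] using hz
    have hwz : ‖w * z‖ < 1 := by
      rw [norm_mul]
      nlinarith [norm_nonneg w, norm_nonneg z]
    have hpos : 0 < ‖1 - w * z‖ := by
      rw [norm_pos_iff, sub_ne_zero]
      rintro h
      rw [← h, norm_one] at hwz
      exact lt_irrefl _ hwz
    have hx : 0 < 1 - ‖z‖ ^ 2 := by nlinarith [norm_nonneg z]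
    rw [Hinner_eq_radialWeight, ← mul_assoc (ENNReal.ofReal (_ ^ (-(2 * _)))),
      ← ENNReal.ofReal_mul (by positivity), ← mul_assoc, ← ENNReal.ofReal_mul (by positivity)]
    congr 2
    rw [norm_deriv_kernel _ _ hwz, norm_div, Complex.norm_real, Complex.norm_cpow_real,
      Real.norm_of_nonneg (Real.rpow_nonneg hr.le _), abs_of_nonneg (Real.rpow_nonneg hr.le _),
      Real.div_rpow (Real.rpow_nonneg hr.le _) (Real.rpow_nonneg hpos.le _),
      ← Real.rpow_mul hr.le, ← Real.rpow_mul hpos.le, mul_pow, mul_pow, mul_pow, sq_abs,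
      ← Real.rpow_mul_natCast hr.le, ← Real.rpow_mul_natCast hpos.le,
      div_eq_mul_inv ((1 - ‖w‖ ^ 2) ^ ((α + 2) / 2 * (p - 2))), ← Real.rpow_neg hpos.le]
    have h₁ : (1 - ‖w‖ ^ 2) ^ (p * (α + 2) / 2) = (1 - ‖w‖ ^ 2) ^ ((α + 2) / 2 * ((2 : ℕ) : ℝ)) *
        (1 - ‖w‖ ^ 2) ^ ((α + 2) / 2 * (p - 2)) := by
      rw [← Real.rpow_add hr]
      congr 1
      push_cast
      ring
    have h₂ : ‖1 - w * z‖ ^ (-(2 * (p * (α + 2) / 2 + 1))) =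
        ‖1 - w * z‖ ^ ((-(α + 2) - 1) * ((2 : ℕ) : ℝ)) *
        ‖1 - w * z‖ ^ (-((α + 2) * (p - 2))) := by
      rw [← Real.rpow_add hpos]
      congr 1
      push_cast
      ring
    rw [h₁, h₂]
    ring

theorem Ffun_kernel_lt_one {α p : ℝ} (hα : -1 ≤ α) (hp : 2 < p) {w : ℂ} (hw : ‖w‖ < 1)
    (hw0 : w ≠ 0) :
    Ffun α p (fun z : ℂ => (((1 - ‖w‖ ^ 2) ^ ((α + 2) / 2) : ℝ) : ℂ) /
      (1 - w * z) ^ ((α + 2 : ℝ) : ℂ)) < 1 := by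
  rw [Ffun_kernel α p hw]
  set b := α + 2 with hb_def
  set q := p * b / 2 with hq_def
  have hb : 1 ≤ b := by linarith
  have hbq : b < q := by
    rw [hq_def]
    nlinarith
  have hq : 1 ≤ q := hb.trans hbq.le
  have hwpos := norm_pos_iff.mpr hw0
  have hr : 0 < 1 - ‖w‖ ^ 2 := by nlinarith
  have hlt := mul_kernelIntegral_lt hb hbq hw hw0
  have hself := mul_kernelIntegral_self hq hw
  have hqtop := kernelIntegral_self_ne_top hq hw hw0
  have hbtop : kernelIntegral q b w ≠ ∞ := by
    intro h
    rw [h, ENNReal.mul_top (by simpa using by linarith)] at hlt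
    exact not_top_lt hlt
  rw [← ENNReal.ofReal_toReal hqtop] at hlt hself
  rw [← ENNReal.ofReal_toReal hbtop] at hlt ⊢
  set x := (kernelIntegral q b w).toReal
  set y := (kernelIntegral q q w).toReal
  have hx : 0 ≤ x := ENNReal.toReal_nonneg
  have hy : 0 ≤ y := ENNReal.toReal_nonneg
  rw [← ENNReal.ofReal_mul (by linarith), ← ENNReal.ofReal_mul (by linarith),
    ENNReal.ofReal_lt_ofReal_iff_of_nonneg (by positivity)] at hlt
  have hinv : 1 ≤ (1 - ‖w‖ ^ 2) ^ (-q) :=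
    Real.one_le_rpow_of_pos_of_le_one_of_nonpos hr (by nlinarith) (by linarith)
  rw [← ENNReal.ofReal_mul (by positivity), ENNReal.ofReal_eq_ofReal_iff (by positivity)
    (mul_nonneg Real.pi_pos.le (by linarith)), Real.rpow_neg hr.le] at hself
  set E := (1 - ‖w‖ ^ 2) ^ q
  have hE : 0 < E := by positivity
  rw [← ENNReal.ofReal_mul (by positivity), ← ENNReal.ofReal_mul (by linarith),
    ← ENNReal.ofReal_div_of_pos Real.pi_pos, ← ENNReal.ofReal_add hE.le (by positivity),
    ENNReal.ofReal_lt_one]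
  have hmain : p / 2 * (b ^ 2 * ‖w‖ ^ 2 * E * x) / Real.pi <
      q * ‖w‖ ^ 2 * E / Real.pi * (q * y) := by
    have : p / 2 * (b ^ 2 * ‖w‖ ^ 2 * E * x) / Real.pi = q * ‖w‖ ^ 2 * E / Real.pi * (b * x) := by
      rw [hq_def]
      ring
    rw [this]
    exact mul_lt_mul_of_pos_left hlt (by positivity)
  have hval : q * ‖w‖ ^ 2 * E / Real.pi * (q * y) = 1 - E := by
    rw [show q * ‖w‖ ^ 2 * E / Real.pi * (q * y) = (q ^ 2 * ‖w‖ ^ 2 * y) * E / Real.pi by ring,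
      hself]
    field_simp
  linarith

/-- for α ≥ -1, p > 2 and ζ ∈ 𝔻 \ {0}, the normalized reproducing kernel
K̃_ζ(z) = (1-|ζ|²)^{(α+2)/2}/(1-conj(ζ)z)^{α+2} satisfies ‖K̃_ζ‖_{A²_α} = 1 and
F_p(K̃_ζ) < 1. -/
theorem statement19 (α p : ℝ) (hα : -1 ≤ α) (hp : 2 < p) (ζ : ℂ) (hζ : ζ ∈ unitDisk)
    (hζ0 : ζ ≠ 0) :
    A2norm α
        (fun z : ℂ => (((1 - ‖ζ‖ ^ 2) ^ ((α + 2) / 2) : ℝ) : ℂ) /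
          (1 - (starRingEnd ℂ) ζ * z) ^ ((α : ℂ) + 2)) = 1 ∧
    Ffun α p
        (fun z : ℂ => (((1 - ‖ζ‖ ^ 2) ^ ((α + 2) / 2) : ℝ) : ℂ) /
          (1 - (starRingEnd ℂ) ζ * z) ^ ((α : ℂ) + 2)) < 1 := by
  have hw : ‖(starRingEnd ℂ) ζ‖ < 1 := by simpa [unitDisk] using hζ
  have hw0 : (starRingEnd ℂ) ζ ≠ 0 := by simpa using hζ0
  have h₁ := A2norm_kernel (α := α) (by linarith) hw
  have h₂ := Ffun_kernel_lt_one hα hp hw hw0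
  push_cast [RCLike.norm_conj] at h₁ h₂ ⊢
  exact ⟨h₁, h₂⟩

end
end
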